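/- Let d ≥ 1, K ≥ 1, and for each k ∈ {1,…,K} let Ω_k ⊂ ℝ^d be the image of the closed Euclidean unit ball under a C^∞ diffeomorphism of ℝ^d, with the sets Ω_1, …, Ω_K pairwise disjoint. Then there exist C^∞ diffeomorphisms T_1, …, T_K : ℝ^d → ℝ^d, each preserving Lebesgue measure, and positive constants c_1, …, c_K > 0, such that the union Ω = Ω_1 ∪ ⋯ ∪ Ω_K satisfies Ω = { y ∈ ℝ^d : min_{1 ≤ k ≤ K} c_k · ‖T_k(y)‖₂² ≤ 1 }. -/

import Mathlib

open MeasureTheory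

/-- A `C^∞` diffeomorphism of `ℝ^d`: a smooth bijection with smooth inverse. -/
def IsSmoothDiffeo {d : ℕ} (T : EuclideanSpace ℝ (Fin d) → EuclideanSpace ℝ (Fin d)) :
    Prop :=
  ContDiff ℝ (⊤ : ℕ∞) T ∧ ∃ S : EuclideanSpace ℝ (Fin d) → EuclideanSpace ℝ (Fin d),
    ContDiff ℝ (⊤ : ℕ∞) S ∧ Function.LeftInverse S T ∧ Function.RightInverse S T

section Helpers
open Set Filter Topology

/-- derivative under the integral sign, `C^1` integrand on a compact interval -/
lemma pi_hasFDerivAt {E F : Type} [NormedAddCommGroup E] [NormedSpace ℝ E] [ProperSpace E]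
    [NormedAddCommGroup F] [NormedSpace ℝ F] [CompleteSpace F]
    {k : E × ℝ → F} (hk : ContDiff ℝ 1 k) (a b : ℝ) (x : E) :
    HasFDerivAt (fun x => ∫ s in a..b, k (x, s))
      (∫ s in a..b, (fderiv ℝ k (x, s)).comp (ContinuousLinearMap.inl ℝ E ℝ)) x := by
  have hcd : Continuous (fderiv ℝ k) := hk.continuous_fderiv (by norm_num)
  have hc : Continuous (fun p : E × ℝ => (fderiv ℝ k p).comp (ContinuousLinearMap.inl ℝ E ℝ)) :=
    hcd.clm_comp continuous_const
  obtain ⟨C, hC⟩ := ((isCompact_closedBall x 1).prod (isCompact_uIcc (a := a) (b := b))).exists_bound_of_continuousOn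
    hc.continuousOn
  refine intervalIntegral.hasFDerivAt_integral_of_dominated_of_fderiv_le (bound := fun _ => C)
    (F' := fun x s => (fderiv ℝ k (x, s)).comp (ContinuousLinearMap.inl ℝ E ℝ))
    (s := Metric.closedBall x 1) (Metric.closedBall_mem_nhds x one_pos) ?_ ?_ ?_ ?_ ?_ ?_
  · exact Eventually.of_forall fun y => (hk.continuous.comp (by fun_prop)).aestronglyMeasurable
  · exact (hk.continuous.comp (by fun_prop)).intervalIntegrable _ _
  · exact (hc.comp (by fun_prop : Continuous fun s : ℝ => (x, s))).aestronglyMeasurable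
  · exact Eventually.of_forall fun t ht y hy => hC (y, t) ⟨hy, uIoc_subset_uIcc ht⟩
  · exact intervalIntegrable_const
  · refine Eventually.of_forall fun t ht y hy => ?_
    have h1 : HasFDerivAt k (fderiv ℝ k (y, t)) (y, t) :=
      (hk.differentiable (by norm_num) _).hasFDerivAt
    exact h1.comp y (hasFDerivAt_prodMk_left y t)

lemma pi_contDiff_nat {E : Type} [NormedAddCommGroup E] [NormedSpace ℝ E] [ProperSpace E] (n : ℕ) :
    ∀ {F : Type} [NormedAddCommGroup F] [NormedSpace ℝ F] [CompleteSpace F]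
    {k : E × ℝ → F} (_ : ContDiff ℝ (⊤ : ℕ∞) k) (a b : ℝ),
    ContDiff ℝ n (fun x => ∫ s in a..b, k (x, s)) := by
  induction n with
  | zero =>
    intro F _ _ _ k hk a b
    have : Differentiable ℝ (fun x => ∫ s in a..b, k (x, s)) := fun x =>
      (pi_hasFDerivAt (hk.of_le (by exact_mod_cast le_top)) a b x).differentiableAt
    exact contDiff_zero.2 this.continuous
  | succ n ih =>
    intro F _ _ _ k hk a b
    have hd := fun x => pi_hasFDerivAt (hk.of_le (by exact_mod_cast le_top)) a b x
    rw [show ((n + 1 : ℕ) : WithTop ℕ∞) = (n : WithTop ℕ∞) + 1 by norm_cast,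
      contDiff_succ_iff_fderiv]
    refine ⟨fun x => (hd x).differentiableAt, by simp, ?_⟩
    have : fderiv ℝ (fun x => ∫ s in a..b, k (x, s)) = fun x =>
      ∫ s in a..b, (fderiv ℝ k (x, s)).comp (ContinuousLinearMap.inl ℝ E ℝ) :=
      funext fun x => (hd x).fderiv
    rw [this]
    refine ih (k := fun p => (fderiv ℝ k p).comp (ContinuousLinearMap.inl ℝ E ℝ)) ?_ a b
    exact (hk.fderiv_right (by simp)).clm_comp contDiff_const

lemma pi_contDiff {E : Type} [NormedAddCommGroup E] [NormedSpace ℝ E] [ProperSpace E]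
    {F : Type} [NormedAddCommGroup F] [NormedSpace ℝ F] [CompleteSpace F]
    {k : E × ℝ → F} (hk : ContDiff ℝ (⊤ : ℕ∞) k) (a b : ℝ) :
    ContDiff ℝ (⊤ : ℕ∞) (fun x => ∫ s in a..b, k (x, s)) :=
  contDiff_infty.2 fun n => pi_contDiff_nat n hk a b

/-- smooth dependence on the parameter and on the upper bound -/
lemma pi_contDiff_upper {E : Type} [NormedAddCommGroup E] [NormedSpace ℝ E] [ProperSpace E]
    {k : E × ℝ → ℝ} (hk : ContDiff ℝ (⊤ : ℕ∞) k) :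
    ContDiff ℝ (⊤ : ℕ∞) (fun p : E × ℝ => ∫ s in (0:ℝ)..p.2, k (p.1, s)) := by
  have h1 : (fun p : E × ℝ => ∫ s in (0:ℝ)..p.2, k (p.1, s)) =
      fun p : E × ℝ => ∫ u in (0:ℝ)..1, p.2 * k (p.1, p.2 * u) := by
    funext p
    have := intervalIntegral.smul_integral_comp_mul_left (a := 0) (b := 1) (fun s => k (p.1, s)) p.2
    simp only [mul_zero, mul_one, smul_eq_mul] at this
    rw [intervalIntegral.integral_const_mul, this]
  rw [h1]
  refine pi_contDiff (k := fun q : (E × ℝ) × ℝ => q.1.2 * k (q.1.1, q.1.2 * q.2)) ?_ 0 1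
  have : ContDiff ℝ (⊤ : ℕ∞) (fun q : (E × ℝ) × ℝ => k (q.1.1, q.1.2 * q.2)) :=
    hk.comp (by fun_prop)
  fun_prop

abbrev EE (d : ℕ) : Type := EuclideanSpace ℝ (Fin d)

/-- the flow: dilation or translation -/
noncomputable def phi {d : ℕ} (l : ℝ) (e : EE d) (s : ℝ) (x : EE d) : EE d :=
  Real.exp (l * s) • x + s • e

/-- Jacobian of the flow -/
noncomputable def JJ (d : ℕ) (l : ℝ) (s : ℝ) : ℝ := Real.exp (d * l * s)

noncomputable def mass {d : ℕ} (l : ℝ) (e : EE d) (g : EE d → ℝ) (x : EE d) (t : ℝ) : ℝ :=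
  ∫ s in (0:ℝ)..t, g (phi l e s x) * JJ d l s

section transport
variable {d : ℕ} {l : ℝ} {e : EE d}

lemma JJ_pos (s : ℝ) : 0 < JJ d l s := Real.exp_pos _

lemma JJ_add (s t : ℝ) : JJ d l (s + t) = JJ d l s * JJ d l t := by
  simp only [JJ]; rw [← Real.exp_add]; ring_nf

lemma JJ_zero : JJ d l 0 = 1 := by simp [JJ]

lemma phi_zero (x : EE d) : phi l e 0 x = x := by simp [phi]

lemma exp_smul_e (hle : l • e = 0) (s : ℝ) : Real.exp (l * s) • e = e := by
  rcases smul_eq_zero.1 hle with h | h <;> simp [h]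

lemma phi_add (hle : l • e = 0) (s t : ℝ) (x : EE d) :
    phi l e s (phi l e t x) = phi l e (s + t) x := by
  have h := exp_smul_e hle s
  simp only [phi, smul_add]
  rw [smul_comm (Real.exp (l * s)) t e, h, mul_add, Real.exp_add, mul_smul, add_smul]
  abel

lemma JJ_contDiff : ContDiff ℝ (⊤ : ℕ∞) (JJ d l) := by
  unfold JJ; fun_prop

lemma phi_contDiff : ContDiff ℝ (⊤ : ℕ∞) (fun p : EE d × ℝ => phi l e p.2 p.1) := by
  unfold phi; fun_prop

lemma phi_hasDerivAt (hle : l • e = 0) (t : ℝ) (x : EE d) :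
    HasDerivAt (fun t => phi l e t x) (l • phi l e t x + e) t := by
  have h1 : HasDerivAt (fun t : ℝ => Real.exp (l * t)) (Real.exp (l * t) * (l * 1)) t :=
    ((hasDerivAt_id t).const_mul l).exp
  have h2 := (h1.smul_const x).add ((hasDerivAt_id t).smul_const e)
  refine h2.congr_deriv ?_
  simp only [phi, smul_add, smul_smul, mul_one, one_smul]
  rw [mul_comm l t, ← smul_smul t l e, hle, mul_comm]; simp

lemma kk_contDiff {g : EE d → ℝ} (hg : ContDiff ℝ (⊤ : ℕ∞) g) :
    ContDiff ℝ (⊤ : ℕ∞) (fun p : EE d × ℝ => g (phi l e p.2 p.1) * JJ d l p.2) :=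
  (hg.comp phi_contDiff).mul (JJ_contDiff.comp contDiff_snd)

lemma mass_contDiff {g : EE d → ℝ} (hg : ContDiff ℝ (⊤ : ℕ∞) g) :
    ContDiff ℝ (⊤ : ℕ∞) (fun p : EE d × ℝ => mass l e g p.1 p.2) :=
  pi_contDiff_upper (kk_contDiff hg)

lemma kk_cont {g : EE d → ℝ} (hg : ContDiff ℝ (⊤ : ℕ∞) g) (x : EE d) :
    Continuous (fun s : ℝ => g (phi l e s x) * JJ d l s) :=
  (kk_contDiff (l := l) (e := e) hg).continuous.comp (by fun_prop : Continuous fun s : ℝ => (x, s))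

lemma mass_hasDerivAt {g : EE d → ℝ} (hg : ContDiff ℝ (⊤ : ℕ∞) g) (x : EE d) (t : ℝ) :
    HasDerivAt (mass l e g x) (g (phi l e t x) * JJ d l t) t :=
  intervalIntegral.integral_hasDerivAt_right ((kk_cont hg x).intervalIntegrable _ _)
    ((kk_cont hg x).stronglyMeasurableAtFilter _ _) (kk_cont hg x).continuousAt

lemma mass_zero (g : EE d → ℝ) (x : EE d) : mass l e g x 0 = 0 := by simp [mass]

lemma mass_strictMono {g : EE d → ℝ} (hg : ContDiff ℝ (⊤ : ℕ∞) g) (hpos : ∀ x, 0 < g x)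
    (x : EE d) : StrictMono (mass l e g x) := by
  refine strictMono_of_deriv_pos fun t => ?_
  rw [(mass_hasDerivAt hg x t).deriv]
  exact mul_pos (hpos _) (JJ_pos _)

lemma mass_shift (hle : l • e = 0) {g : EE d → ℝ} (hg : ContDiff ℝ (⊤ : ℕ∞) g) (x : EE d)
    (t u : ℝ) : mass l e g (phi l e t x) u * JJ d l t = mass l e g x (t + u) - mass l e g x t := by
  unfold mass
  rw [intervalIntegral.integral_interval_sub_left ((kk_cont hg x).intervalIntegrable _ _)
    ((kk_cont hg x).intervalIntegrable _ _), ← intervalIntegral.integral_mul_const]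
  have := intervalIntegral.integral_comp_add_right (a := 0) (b := u)
    (fun s => g (phi l e s x) * JJ d l s) t
  rw [zero_add, add_comm u t] at this
  rw [← this]
  congr 1; funext s
  rw [phi_add hle, JJ_add, mul_assoc]

/-- `div (a v) = f0 - f1` where `v x = l x + e` -/
def DivEq (l : ℝ) (e : EE d) (a f0 f1 : EE d → ℝ) : Prop :=
  ∀ x, fderiv ℝ a x (l • x + e) + d * l * a x = f0 x - f1 x

lemma a_flow (hle : l • e = 0) {a f0 f1 : EE d → ℝ} (ha : ContDiff ℝ (⊤ : ℕ∞) a)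
    (h0 : ContDiff ℝ (⊤ : ℕ∞) f0) (h1 : ContDiff ℝ (⊤ : ℕ∞) f1) (hdiv : DivEq l e a f0 f1)
    (x : EE d) (t : ℝ) :
    a (phi l e t x) * JJ d l t = a x + mass l e f0 x t - mass l e f1 x t := by
  have key : ∀ t, HasDerivAt (fun t => a (phi l e t x) * JJ d l t -
      (mass l e f0 x t - mass l e f1 x t)) 0 t := by
    intro t
    have hA : HasDerivAt (fun t => a (phi l e t x))
        (fderiv ℝ a (phi l e t x) (l • phi l e t x + e)) t :=
      ((ha.differentiable (by simp) _).hasFDerivAt).comp_hasDerivAt t (phi_hasDerivAt hle t x)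
    have hJ : HasDerivAt (JJ d l) (JJ d l t * (d * l * 1)) t :=
      ((hasDerivAt_id t).const_mul (d * l)).exp
    refine ((hA.mul hJ).sub ((mass_hasDerivAt h0 x t).sub (mass_hasDerivAt h1 x t))).congr_deriv ?_
    have := hdiv (phi l e t x)
    linear_combination JJ d l t * this
  have hc := is_const_of_deriv_eq_zero (fun t => (key t).differentiableAt)
    (fun t => (key t).deriv) t 0
  simp only [phi_zero, JJ_zero, mass_zero] at hc
  linarith

def Solvable (l : ℝ) (e : EE d) (g a : EE d → ℝ) : Prop :=
  ∀ x, (∃ S, a x ≤ mass l e g x S) ∧ ∃ S, mass l e g x S ≤ a x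

lemma exists_tau {g a : EE d → ℝ} (hg : ContDiff ℝ (⊤ : ℕ∞) g)
    (hs : Solvable l e g a) : ∃ τ : EE d → ℝ, ∀ x, mass l e g x (τ x) = a x := by
  have : ∀ x, ∃ t, mass l e g x t = a x := by
    intro x
    obtain ⟨⟨S, hS⟩, S', hS'⟩ := hs x
    have hc : Continuous (mass l e g x) :=
      continuous_iff_continuousAt.2 fun t => (mass_hasDerivAt hg x t).continuousAt
    exact mem_range_of_exists_le_of_exists_ge hc ⟨S', hS'⟩ ⟨S, hS⟩
  choose τ hτ using this
  exact ⟨τ, hτ⟩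

lemma tau_contDiff {g a : EE d → ℝ} (hg : ContDiff ℝ (⊤ : ℕ∞) g) (hpos : ∀ x, 0 < g x)
    (ha : ContDiff ℝ (⊤ : ℕ∞) a) {τ : EE d → ℝ} (hτ : ∀ x, mass l e g x (τ x) = a x) :
    ContDiff ℝ (⊤ : ℕ∞) τ := by
  rw [contDiff_iff_contDiffAt]
  intro x
  set f : EE d × ℝ → ℝ := fun p => mass l e g p.1 p.2 - a p.1 with hf
  have hfc : ContDiff ℝ (⊤ : ℕ∞) f := (mass_contDiff hg).sub (ha.comp contDiff_fst)
  have cdf : ContDiffAt ℝ (⊤ : ℕ∞) f (x, τ x) := hfc.contDiffAt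
  have hder : HasFDerivAt f (fderiv ℝ f (x, τ x)) (x, τ x) :=
    (hfc.differentiable (by simp) _).hasFDerivAt
  have h1 : HasDerivAt (fun t => f (x, t)) (g (phi l e (τ x) x) * JJ d l (τ x)) (τ x) :=
    (mass_hasDerivAt (l := l) (e := e) hg x (τ x)).sub_const (a x)
  have h2 : HasDerivAt (fun t => f (x, t)) ((fderiv ℝ f (x, τ x)) (0, 1)) (τ x) :=
    hder.comp_hasDerivAt (τ x) ((hasDerivAt_const (τ x) x).prodMk (hasDerivAt_id (τ x)))
  have h3 := h1.unique h2
  have hne : (fderiv ℝ f (x, τ x)) (0, 1) ≠ 0 := by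
    rw [← h3]; exact (mul_pos (hpos _) (JJ_pos _)).ne'
  have hinv : (fderiv ℝ f (x, τ x) ∘L .inr ℝ (EE d) ℝ).IsInvertible := by
    refine ⟨ContinuousLinearEquiv.unitsEquivAut ℝ (Units.mk0 _ hne), ?_⟩
    ext
    simp
  have hz : ∀ y, f (y, τ y) = 0 := fun y => by simp [hf, hτ]
  have hev := cdf.eventually_apply_implicitFunction (by simp) hinv
  have hcd := cdf.contDiffAt_implicitFunction (by simp) hinv
  refine hcd.congr_of_eventuallyEq ?_
  filter_upwards [hev] with y hy
  apply (mass_strictMono hg hpos y (l := l) (e := e)).injective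
  rw [hz x] at hy
  rw [hτ]
  simp only [hf] at hy
  linarith

lemma transport (hle : l • e = 0) {a f0 f1 : EE d → ℝ} (ha : ContDiff ℝ (⊤ : ℕ∞) a)
    (h0 : ContDiff ℝ (⊤ : ℕ∞) f0) (h1 : ContDiff ℝ (⊤ : ℕ∞) f1)
    (p0 : ∀ x, 0 < f0 x) (p1 : ∀ x, 0 < f1 x) (hdiv : DivEq l e a f0 f1)
    (s1 : Solvable l e f1 a) (s0 : Solvable l e f0 (fun x => - a x)) :
    ∃ τ : EE d → ℝ, (∀ x, mass l e f1 x (τ x) = a x) ∧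
      (∀ x t, mass l e f1 x (t + τ (phi l e t x)) = a x + mass l e f0 x t) ∧
      IsSmoothDiffeo (fun x => phi l e (τ x) x) ∧
      ∀ x, f0 x = f1 (phi l e (τ x) x) * |(fderiv ℝ (fun x => phi l e (τ x) x) x).det| := by
  obtain ⟨τ, hτ⟩ := exists_tau h1 s1
  obtain ⟨σ, hσ⟩ := exists_tau h0 s0
  have cτ := tau_contDiff h1 p1 ha hτ
  have cσ := tau_contDiff h0 p0 ha.neg hσ
  have hk : ∀ x t, mass l e f1 x (t + τ (phi l e t x)) = a x + mass l e f0 x t := by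
    intro x t
    have e1 := mass_shift hle h1 x t (τ (phi l e t x))
    rw [hτ, a_flow hle ha h0 h1 hdiv] at e1
    linarith
  refine ⟨τ, hτ, hk, ⟨phi_contDiff.comp (contDiff_id.prodMk cτ),
    fun y => phi l e (σ y) y, phi_contDiff.comp (contDiff_id.prodMk cσ), ?_, ?_⟩, ?_⟩
  · intro x
    have : σ (phi l e (τ x) x) = - τ x := by
      apply (mass_strictMono h0 p0 (phi l e (τ x) x) (l := l) (e := e)).injective
      rw [hσ]
      have e1 := mass_shift hle h0 x (τ x) (-τ x)
      rw [add_neg_cancel, mass_zero] at e1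
      have e2 := a_flow hle ha h0 h1 hdiv x (τ x)
      rw [hτ] at e2
      have := JJ_pos (d := d) (l := l) (τ x)
      apply mul_right_cancel₀ this.ne'
      linarith
    simp only [this, phi_add hle, neg_add_cancel, phi_zero]
  · intro x
    have : τ (phi l e (σ x) x) = - σ x := by
      apply (mass_strictMono h1 p1 (phi l e (σ x) x) (l := l) (e := e)).injective
      rw [hτ]
      have e1 := mass_shift hle h1 x (σ x) (-σ x)
      rw [add_neg_cancel, mass_zero] at e1
      have e2 := a_flow hle ha h0 h1 hdiv x (σ x)
      rw [hσ] at e2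
      have := JJ_pos (d := d) (l := l) (σ x)
      apply mul_right_cancel₀ this.ne'
      linarith
    simp only [this, phi_add hle, neg_add_cancel, phi_zero]
  · intro x
    have dτ : HasFDerivAt τ (fderiv ℝ τ x) x := (cτ.differentiable (by simp) _).hasFDerivAt
    set v : EE d := l • x + e with hv
    -- derivative of `k`
    have hkd : HasDerivAt (fun t : ℝ => t + τ (phi l e t x)) (1 + fderiv ℝ τ x v) 0 := by
      refine (hasDerivAt_id (0:ℝ)).add ?_
      have := phi_hasDerivAt (l := l) (e := e) hle 0 x
      rw [phi_zero] at this
      refine HasFDerivAt.comp_hasDerivAt (0:ℝ) ?_ this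
      rw [phi_zero]; exact dτ
    have d1 : HasDerivAt (fun t : ℝ => mass l e f1 x (t + τ (phi l e t x)))
        (f1 (phi l e (τ x) x) * JJ d l (τ x) * (1 + fderiv ℝ τ x v)) 0 := by
      refine HasDerivAt.comp (h₂ := mass l e f1 x) (0:ℝ) ?_ hkd
      simp only [phi_zero, zero_add]
      exact mass_hasDerivAt h1 x (τ x)
    have d2 : HasDerivAt (fun t : ℝ => a x + mass l e f0 x t) (f0 x) 0 := by
      have := (mass_hasDerivAt (l := l) (e := e) h0 x 0).const_add (a x)
      simpa only [phi_zero, JJ_zero, mul_one] using this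
    have d3 : f1 (phi l e (τ x) x) * JJ d l (τ x) * (1 + fderiv ℝ τ x v) = f0 x := by
      refine HasDerivAt.unique ?_ d2
      simpa only [← hk] using d1
    have hpos : 0 < 1 + fderiv ℝ τ x v := by
      have : 0 < f1 (phi l e (τ x) x) * JJ d l (τ x) := mul_pos (p1 _) (JJ_pos _)
      have h2 := p0 x
      rw [← d3] at h2
      exact (pos_iff_pos_of_mul_pos h2).1 this
    -- derivative of `G`
    set A : EE d →L[ℝ] EE d := Real.exp (l * τ x) •
      (ContinuousLinearMap.id ℝ (EE d) + (fderiv ℝ τ x).smulRight v) with hA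
    have hG : HasFDerivAt (fun x => phi l e (τ x) x) A x := by
      have g1 : HasFDerivAt (fun x => Real.exp (l * τ x))
          (Real.exp (l * τ x) • (l • fderiv ℝ τ x)) x := (dτ.const_mul l).exp
      have g2 := (g1.smul (hasFDerivAt_id x)).add (dτ.smul_const e)
      refine g2.congr_fderiv ?_
      ext1 w
      have he := exp_smul_e hle (τ x)
      simp only [hA, hv, add_apply, smul_apply,
        ContinuousLinearMap.smulRight_apply, ContinuousLinearMap.id_apply, smul_add, id_eq,
        smul_eq_mul]
      rw [smul_comm (Real.exp (l * τ x)) (fderiv ℝ τ x w) e, he]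
      simp only [smul_smul]
      rw [add_assoc]
      congr 3
      ring
    rw [hG.fderiv]
    have hdet : A.det = JJ d l (τ x) * (1 + fderiv ℝ τ x v) := by
      have : ((ContinuousLinearMap.id ℝ (EE d) + (fderiv ℝ τ x).smulRight v :
          EE d →L[ℝ] EE d) : EE d →ₗ[ℝ] EE d) =
          LinearMap.transvection (fderiv ℝ τ x : EE d →ₗ[ℝ] ℝ) v := by
        ext1 w; simp [LinearMap.transvection.apply]
      rw [hA, ContinuousLinearMap.det, ContinuousLinearMap.toLinearMap_smul, LinearMap.det_smul,
        this, LinearMap.transvection.det]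
      congr 1
      rw [finrank_euclideanSpace, Fintype.card_fin, JJ, ← Real.exp_nat_mul]
      ring_nf
    rw [hdet, abs_of_pos (mul_pos (JJ_pos _) hpos), ← d3]
    ring

end transport

def Tr {d : ℕ} (f g : EE d → ℝ) : Prop :=
  ∃ G : EE d → EE d, IsSmoothDiffeo G ∧ G '' Metric.closedBall 0 1 = Metric.closedBall 0 1 ∧
    ∀ x, g x = f (G x) * |(fderiv ℝ G x).det|

lemma IsSmoothDiffeo.comp' {d : ℕ} {F G : EE d → EE d} (hF : IsSmoothDiffeo F)
    (hG : IsSmoothDiffeo G) : IsSmoothDiffeo (fun x => F (G x)) := by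
  obtain ⟨hF, F', hF', l1, r1⟩ := hF
  obtain ⟨hG, G', hG', l2, r2⟩ := hG
  refine ⟨hF.comp hG, fun x => G' (F' x), hG'.comp hF', fun x => ?_, fun x => ?_⟩
  · simp [l1 (G x), l2 x]
  · simp [r2 (F' x), r1 x]

lemma IsSmoothDiffeo.bij {d : ℕ} {F : EE d → EE d} (hF : IsSmoothDiffeo F) :
    Function.Bijective F := by
  obtain ⟨hF, F', hF', l1, r1⟩ := hF
  exact ⟨l1.injective, r1.surjective⟩

lemma IsSmoothDiffeo.diff {d : ℕ} {F : EE d → EE d} (hF : IsSmoothDiffeo F) :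
    Differentiable ℝ F := hF.1.differentiable (by simp)

lemma Tr.refl {d : ℕ} (f : EE d → ℝ) : Tr f f := by
  refine ⟨fun x => x, ⟨contDiff_id, fun x => x, contDiff_id, fun x => rfl, fun x => rfl⟩,
    by simp, fun x => ?_⟩
  have : fderiv ℝ (fun x : EE d => x) x = ContinuousLinearMap.id ℝ _ := fderiv_id
  rw [this]
  simp [ContinuousLinearMap.det]

lemma det_fderiv_comp {d : ℕ} {F G : EE d → EE d} (hF : Differentiable ℝ F)
    (hG : Differentiable ℝ G) (x : EE d) :
    (fderiv ℝ (fun x => F (G x)) x).det = (fderiv ℝ F (G x)).det * (fderiv ℝ G x).det := by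
  have : fderiv ℝ (fun x => F (G x)) x = (fderiv ℝ F (G x)).comp (fderiv ℝ G x) :=
    fderiv_comp x (hF _) (hG _)
  rw [this]
  simp [ContinuousLinearMap.det]

lemma Tr.trans {d : ℕ} {f g h : EE d → ℝ} (h1 : Tr f g) (h2 : Tr g h) : Tr f h := by
  obtain ⟨F, hF, hFB, hFe⟩ := h1
  obtain ⟨G, hG, hGB, hGe⟩ := h2
  refine ⟨fun x => F (G x), hF.comp' hG, ?_, fun x => ?_⟩
  · rw [← Set.image_image F G, hGB, hFB]
  · rw [hGe, hFe, det_fderiv_comp hF.diff hG.diff, abs_mul, mul_assoc]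

lemma ball_of_fix {d : ℕ} {G : EE d → EE d} (hG : IsSmoothDiffeo G)
    (h : ∀ x, 1 ≤ ‖x‖ → G x = x) : G '' Metric.closedBall 0 1 = Metric.closedBall 0 1 := by
  ext y
  simp only [Set.mem_image, mem_closedBall_zero_iff]
  constructor
  · rintro ⟨x, hx, rfl⟩
    by_contra hc
    push Not at hc
    have := hG.bij.1 (h (G x) hc.le)
    rw [this] at hc
    linarith
  · intro hy
    obtain ⟨x, rfl⟩ := hG.bij.2 y
    refine ⟨x, ?_, rfl⟩
    by_contra hc
    push Not at hc
    rw [h x hc.le] at hy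
    linarith

lemma stepA {d : ℕ} {e : EE d} (he : e ≠ 0) {a f0 f1 : EE d → ℝ} (ha : ContDiff ℝ (⊤ : ℕ∞) a)
    (h0 : ContDiff ℝ (⊤ : ℕ∞) f0) (h1 : ContDiff ℝ (⊤ : ℕ∞) f1)
    (p0 : ∀ x, 0 < f0 x) (p1 : ∀ x, 0 < f1 x) (hv : ∀ x, 1 ≤ ‖x‖ → a x = 0)
    (hdiv : ∀ x, f0 x = f1 x + fderiv ℝ a x e) : Tr f1 f0 := by
  have hle : (0 : ℝ) • e = 0 := zero_smul _ _
  have hD : DivEq 0 e a f0 f1 := fun x => by simp [hdiv x]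
  have hS : ∀ x, ∃ S, 0 ≤ S ∧ a (phi 0 e S x) = 0 ∧ a (phi 0 e (-S) x) = 0 := by
    intro x
    have hn : 0 < ‖e‖ := norm_pos_iff.2 he
    refine ⟨(1 + ‖x‖) / ‖e‖, by positivity, hv _ ?_, hv _ ?_⟩
    · simp only [phi, zero_mul, Real.exp_zero, one_smul]
      have := norm_sub_norm_le (((1 + ‖x‖) / ‖e‖) • e) (-x)
      rw [sub_neg_eq_add, norm_neg, norm_smul, Real.norm_of_nonneg (by positivity),
        div_mul_cancel₀ _ hn.ne', add_comm _ x] at this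
      linarith
    · simp only [phi, zero_mul, Real.exp_zero, one_smul]
      have := norm_sub_norm_le (((1 + ‖x‖) / ‖e‖) • e) x
      rw [norm_smul, Real.norm_of_nonneg (by positivity),
        div_mul_cancel₀ _ hn.ne', norm_sub_rev] at this
      rw [neg_smul, ← sub_eq_add_neg]
      linarith
  have hm : ∀ {g : EE d → ℝ}, ContDiff ℝ (⊤ : ℕ∞) g → (∀ x, 0 < g x) → ∀ x S, 0 ≤ S →
      0 ≤ mass 0 e g x S ∧ mass 0 e g x (-S) ≤ 0 := by
    intro g hg hp x S hS
    have := (mass_strictMono (l := 0) (e := e) hg hp x).monotone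
    have h1 := this hS
    have h2 := this (neg_nonpos.2 hS)
    rw [mass_zero] at h1 h2
    exact ⟨h1, h2⟩
  obtain ⟨τ, hτ, -, hG, hdet⟩ := transport hle ha h0 h1 p0 p1 hD (fun x => by
      obtain ⟨S, hS, e1, e2⟩ := hS x
      have b1 := a_flow hle ha h0 h1 hD x S
      have b2 := a_flow hle ha h0 h1 hD x (-S)
      rw [e1] at b1; rw [e2] at b2
      have := hm h0 p0 x S hS
      exact ⟨⟨S, by linarith⟩, ⟨-S, by linarith⟩⟩) (fun x => by
      obtain ⟨S, hS, e1, e2⟩ := hS x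
      have b1 := a_flow hle ha h0 h1 hD x S
      have b2 := a_flow hle ha h0 h1 hD x (-S)
      rw [e1] at b1; rw [e2] at b2
      have := hm h1 p1 x S hS
      exact ⟨⟨S, by linarith⟩, ⟨-S, by linarith⟩⟩)
  refine ⟨_, hG, ball_of_fix hG fun x hx => ?_, hdet⟩
  have : τ x = 0 := by
    apply (mass_strictMono (l := 0) (e := e) h1 p1 x).injective
    rw [hτ, mass_zero, hv x hx]
  rw [this, phi_zero]

noncomputable abbrev ee {d : ℕ} (i : Fin d) : EE d := EuclideanSpace.single i (1 : ℝ)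

lemma ee_ne {d : ℕ} (i : Fin d) : (ee i : EE d) ≠ 0 := by
  intro h
  have := congrArg norm h
  simp at this

lemma fderiv_apply_contDiff {d : ℕ} {a : EE d → ℝ} (ha : ContDiff ℝ (⊤ : ℕ∞) a) (v : EE d) :
    ContDiff ℝ (⊤ : ℕ∞) (fun x => fderiv ℝ a x v) :=
  (ha.fderiv_right (m := ((⊤ : ℕ∞) : WithTop ℕ∞)) (by simp)).clm_apply contDiff_const

lemma fderiv_zero_of_vanish {d : ℕ} {a : EE d → ℝ} (hv : ∀ x, 1 ≤ ‖x‖ → a x = 0) {x : EE d}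
    (hx : 1 < ‖x‖) : fderiv ℝ a x = 0 := by
  have : a =ᶠ[𝓝 x] fun _ => 0 := by
    filter_upwards [continuous_norm.continuousAt.eventually (lt_mem_nhds hx)] with y hy
    exact hv y (le_of_lt hy)
  rw [this.fderiv_eq]; simp

lemma stepSmall {d : ℕ} {a : Fin d → EE d → ℝ} (ha : ∀ i, ContDiff ℝ (⊤ : ℕ∞) (a i))
    (hv : ∀ i x, 1 ≤ ‖x‖ → a i x = 0) {g : EE d → ℝ} (hg : ContDiff ℝ (⊤ : ℕ∞) g)
    (hp : ∀ (s : Finset (Fin d)) x, 0 < g x + ∑ i ∈ s, fderiv ℝ (a i) x (ee i))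
    (s : Finset (Fin d)) : Tr g (fun x => g x + ∑ i ∈ s, fderiv ℝ (a i) x (ee i)) := by
  have hsm : ∀ s : Finset (Fin d), ContDiff ℝ (⊤ : ℕ∞)
      (fun x => g x + ∑ i ∈ s, fderiv ℝ (a i) x (ee i)) := fun s =>
    hg.add (ContDiff.sum fun i _ => fderiv_apply_contDiff (ha i) _)
  classical
  induction s using Finset.induction_on with
  | empty => simpa using Tr.refl g
  | insert k s hk ih =>
    refine ih.trans (stepA (ee_ne k) (ha k) (hsm _) (hsm _) (hp _) (hp _) (hv k) fun x => ?_)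
    rw [Finset.sum_insert hk]; ring

lemma stepB {d : ℕ} {a : Fin d → EE d → ℝ} (ha : ∀ i, ContDiff ℝ (⊤ : ℕ∞) (a i))
    (hv : ∀ i x, 1 ≤ ‖x‖ → a i x = 0) {f1 : EE d → ℝ} (hf : ContDiff ℝ (⊤ : ℕ∞) f1)
    (p1 : ∀ x, 0 < f1 x) (p2 : ∀ x, 0 < f1 x + ∑ i, fderiv ℝ (a i) x (ee i)) :
    Tr f1 (fun x => f1 x + ∑ i, fderiv ℝ (a i) x (ee i)) := by
  set H : EE d → ℝ := fun x => ∑ i, fderiv ℝ (a i) x (ee i) with hH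
  set P : EE d → ℝ := fun x => ∑ i, |fderiv ℝ (a i) x (ee i)| with hP
  have hHs : ContDiff ℝ (⊤ : ℕ∞) H := ContDiff.sum fun i _ => fderiv_apply_contDiff (ha i) _
  have hPc : Continuous P :=
    continuous_finsetSum _ fun i _ => (fderiv_apply_contDiff (ha i) _).continuous.abs
  have hmin : ∀ x, 0 < min (f1 x) (f1 x + H x) := fun x => lt_min (p1 x) (p2 x)
  obtain ⟨C, hC⟩ := (isCompact_closedBall (0 : EE d) 1).exists_bound_of_continuousOn
    (f := fun x => P x / min (f1 x) (f1 x + H x))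
    ((hPc.div (hf.continuous.min (hf.continuous.add hHs.continuous))
      fun x => (hmin x).ne').continuousOn)
  obtain ⟨n, hn⟩ := exists_nat_gt C
  set N : ℝ := ((n + 1 : ℕ) : ℝ) with hN
  have hN0 : 0 < N := by simp only [hN]; positivity
  have hPN : ∀ x, P x / N < min (f1 x) (f1 x + H x) := by
    intro x
    by_cases hx : ‖x‖ ≤ 1
    · have h1 := (le_abs_self _).trans (hC x (by simpa using hx))
      rw [div_le_iff₀ (hmin x)] at h1
      rw [div_lt_iff₀ hN0]
      have : C < N := by rw [hN]; push_cast; linarith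
      nlinarith [hmin x]
    · push Not at hx
      have : P x = 0 := by
        simp only [hP]
        refine Finset.sum_eq_zero fun i _ => ?_
        rw [fderiv_zero_of_vanish (hv i) hx]; simp
      rw [this, zero_div]; exact hmin x
  have key : ∀ j : ℕ, j ≤ n + 1 → Tr f1 (fun x => f1 x + (j / N) * H x) := by
    intro j
    induction j with
    | zero => intro _; simpa using Tr.refl f1
    | succ j ih =>
      intro hj
      refine (ih (by omega)).trans ?_
      have hd : ∀ i x, fderiv ℝ (fun x => N⁻¹ * a i x) x (ee i) = N⁻¹ * fderiv ℝ (a i) x (ee i) := by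
        intro i x
        rw [fderiv_const_mul (((ha i).differentiable (by simp)) x)]; simp
      have := stepSmall (a := fun i x => N⁻¹ * a i x) (fun i => contDiff_const.mul (ha i))
        (fun i x hx => by simp [hv i x hx]) (g := fun x => f1 x + (j / N) * H x)
        (hf.add (contDiff_const.mul hHs)) (fun s x => ?_) Finset.univ
      · convert this using 2 with x
        simp only [hd, ← Finset.mul_sum]
        push_cast; simp only [hH]; ring
      · simp only [hd, ← Finset.mul_sum]
        have e1 : |∑ i ∈ s, fderiv ℝ (a i) x (ee i)| ≤ P x :=
          (Finset.abs_sum_le_sum_abs _ _).trans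
            (Finset.sum_le_sum_of_subset_of_nonneg (Finset.subset_univ s) fun i _ _ => abs_nonneg _)
        have e2 := neg_le_of_abs_le e1
        have e3 := hPN x
        have hj0 : 0 ≤ (j:ℝ) / N := by positivity
        have hj1 : (j:ℝ) / N ≤ 1 := by
          rw [div_le_one hN0, hN]; exact_mod_cast (by omega : j ≤ n + 1)
        have e4 : min (f1 x) (f1 x + H x) ≤ f1 x + j / N * H x := by
          have h1 := min_le_left (f1 x) (f1 x + H x)
          have h2 := min_le_right (f1 x) (f1 x + H x)
          nlinarith
        have e5 : -(P x / N) ≤ N⁻¹ * ∑ i ∈ s, fderiv ℝ (a i) x (ee i) := by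
          have := mul_le_mul_of_nonneg_left e2 (inv_pos.2 hN0).le
          calc _ = N⁻¹ * -P x := by ring
            _ ≤ _ := this
        linarith
  have := key (n + 1) le_rfl
  rw [← hN, div_self hN0.ne'] at this
  simpa using this

def CV {d : ℕ} (w : ℝ) (h : EE d → ℝ) : Prop := ∀ x : EE d, (∃ i, w ≤ |x i|) → h x = 0

noncomputable def upd {d : ℕ} (x : EE d) (k : Fin d) (t : ℝ) : EE d := x + (t - x k) • ee k

lemma upd_same {d : ℕ} (x : EE d) (k : Fin d) (t : ℝ) : upd x k t k = t := by simp [upd]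

lemma upd_ne {d : ℕ} (x : EE d) {k j : Fin d} (h : j ≠ k) (t : ℝ) : upd x k t j = x j := by
  simp [upd, h]

lemma upd_self {d : ℕ} (x : EE d) (k : Fin d) : upd x k (x k) = x := by simp [upd]

lemma upd_ext {d : ℕ} {x y : EE d} {k : Fin d} (h : ∀ j, j ≠ k → x j = y j) (t : ℝ) :
    upd x k t = upd y k t := by
  ext j
  by_cases hj : j = k
  · subst hj; simp [upd_same]
  · simp [upd_ne _ hj, h j hj]

lemma coord_contDiff {d : ℕ} (k : Fin d) : ContDiff ℝ (⊤ : ℕ∞) (fun x : EE d => x k) := by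
  fun_prop

lemma upd_contDiff {d : ℕ} (k : Fin d) :
    ContDiff ℝ (⊤ : ℕ∞) (fun p : EE d × ℝ => upd p.1 k p.2) := by
  unfold upd
  have h : ContDiff ℝ (⊤ : ℕ∞) (fun p : EE d × ℝ => p.1 k) := (coord_contDiff k).comp contDiff_fst
  exact contDiff_fst.add ((contDiff_snd.sub h).smul contDiff_const)

lemma cube_step {d : ℕ} {w : ℝ} (hw : 0 < w) {β : ℝ → ℝ} (hβ : ContDiff ℝ (⊤ : ℕ∞) β)
    (hβ0 : ∀ t, w ≤ |t| → β t = 0) (hβ1 : ∫ t in (-w)..w, β t = 1)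
    {r : EE d → ℝ} (hr : ContDiff ℝ (⊤ : ℕ∞) r) (hv : CV w r) (k : Fin d) :
    ∃ a : EE d → ℝ, ContDiff ℝ (⊤ : ℕ∞) a ∧ CV w a ∧
      CV w (fun x => β (x k) * ∫ t in (-w)..w, r (upd x k t)) ∧
      ∀ x, r x = fderiv ℝ a x (ee k) + β (x k) * ∫ t in (-w)..w, r (upd x k t) := by
  set I : EE d → ℝ := fun x => ∫ t in (-w)..w, r (upd x k t) with hI
  have hIs : ContDiff ℝ (⊤ : ℕ∞) I := pi_contDiff (k := fun p => r (upd p.1 k p.2))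
    (hr.comp (upd_contDiff k)) _ _
  have hIu : ∀ x y, (∀ j, j ≠ k → x j = y j) → I x = I y := by
    intro x y h
    simp only [hI, upd_ext h]
  set q : EE d → ℝ := fun x => r x - β (x k) * I x with hq
  have hr's : ContDiff ℝ (⊤ : ℕ∞) (fun x => β (x k) * I x) := (hβ.comp (coord_contDiff k)).mul hIs
  have hqs : ContDiff ℝ (⊤ : ℕ∞) q := hr.sub hr's
  have hv' : CV w (fun x => β (x k) * I x) := by
    rintro x ⟨i, hi⟩
    by_cases hik : i = k
    · subst hik; simp [hβ0 _ hi]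
    · have : I x = 0 := by
        simp only [hI]
        have : ∀ t, r (upd x k t) = 0 := fun t => hv _ ⟨i, by rwa [upd_ne _ hik]⟩
        simp [this]
      simp [this]
  have hqv : CV w q := fun x hx => by
    have := hv' x hx
    simp only [hq] at this ⊢; rw [hv x hx, this, sub_zero]
  have hqu : ContDiff ℝ (⊤ : ℕ∞) (fun p : EE d × ℝ => q (upd p.1 k p.2)) :=
    hqs.comp (upd_contDiff k)
  have hqc : ∀ x, Continuous fun t => q (upd x k t) := fun x =>
    hqu.continuous.comp (by fun_prop : Continuous fun t : ℝ => (x, t))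
  have hii : ∀ x a b, IntervalIntegrable (fun t => q (upd x k t)) volume a b := fun x a b =>
    (hqc x).intervalIntegrable _ _
  refine ⟨fun x => ∫ t in (-w)..(x k), q (upd x k t), ?_, ?_, hv', ?_⟩
  · have h1 := (pi_contDiff_upper hqu).comp (contDiff_id.prodMk (coord_contDiff k))
    have h2 := (pi_contDiff_upper hqu).comp
      (contDiff_id.prodMk (contDiff_const (c := -w) (E := EE d)))
    convert h1.sub h2 using 1
    funext x
    simp only [Function.comp, id]
    rw [intervalIntegral.integral_interval_sub_left (hii x _ _) (hii x _ _)]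
  · rintro x ⟨i, hi⟩
    by_cases hik : i = k
    · subst hik
      rcases le_total 0 (x i) with h0 | h0
      · rw [abs_of_nonneg h0] at hi
        show ∫ t in (-w)..(x i), q (upd x i t) = 0
        rw [← intervalIntegral.integral_add_adjacent_intervals (hii x (-w) w) (hii x w (x i))]
        have e1 : ∫ t in w..(x i), q (upd x i t) = 0 := by
          rw [intervalIntegral.integral_congr (g := fun _ => (0:ℝ))]
          · simp
          · intro t ht
            rw [uIcc_of_le hi] at ht
            exact hqv _ ⟨i, by rw [upd_same]; exact ht.1.trans (le_abs_self _)⟩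
        have e2 : ∫ t in (-w)..w, q (upd x i t) = 0 := by
          have : ∀ t, q (upd x i t) = r (upd x i t) - β t * I x := by
            intro t
            simp only [hq]
            rw [upd_same, hIu (upd x i t) x fun j hj => upd_ne x hj t]
          simp only [this]
          rw [intervalIntegral.integral_sub, intervalIntegral.integral_mul_const, hβ1, one_mul]
          · simp [hI]
          · exact (((hr.comp (upd_contDiff i)).continuous.comp
              (by fun_prop : Continuous fun t : ℝ => (x, t))).intervalIntegrable _ _)
          · exact (hβ.continuous.mul continuous_const).intervalIntegrable _ _
        rw [e1, e2, add_zero]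
      · rw [abs_of_nonpos h0] at hi
        show ∫ t in (-w)..(x i), q (upd x i t) = 0
        rw [intervalIntegral.integral_congr (g := fun _ => (0:ℝ))]
        · simp
        · intro t ht
          rw [uIcc_of_ge (by linarith)] at ht
          exact hqv _ ⟨i, by rw [upd_same]; exact (by linarith [ht.2] : w ≤ -t).trans (neg_le_abs _)⟩
    · have : ∀ t, q (upd x k t) = 0 := fun t => hqv _ ⟨i, by rwa [upd_ne _ hik]⟩
      simp [this]
  · intro x
    have hs : ContDiff ℝ (⊤ : ℕ∞) (fun x : EE d => ∫ t in (-w)..(x k), q (upd x k t)) := by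
      have h1 := (pi_contDiff_upper hqu).comp (contDiff_id.prodMk (coord_contDiff k))
      have h2 := (pi_contDiff_upper hqu).comp
        (contDiff_id.prodMk (contDiff_const (c := -w) (E := EE d)))
      convert h1.sub h2 using 1
      funext x
      simp only [Function.comp, id]
      rw [intervalIntegral.integral_interval_sub_left (hii x _ _) (hii x _ _)]
    have d1 : HasDerivAt (fun s : ℝ => upd x k s) (ee k) (x k) := by
      unfold upd
      simpa using (((hasDerivAt_id (x k)).sub_const (x k)).smul_const (ee k : EE d)).const_add x
    have d2 := ((hs.differentiable (by simp)) (upd x k (x k))).hasFDerivAt.comp_hasDerivAt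
      (x k) d1
    have d3 : HasDerivAt (fun s : ℝ => ∫ t in (-w)..s, q (upd x k t)) (q (upd x k (x k))) (x k) :=
      intervalIntegral.integral_hasDerivAt_right (hii x _ _)
        ((hqc x).stronglyMeasurableAtFilter _ _) (hqc x).continuousAt
    have d4 : ((fun x : EE d => ∫ t in (-w)..(x k), q (upd x k t)) ∘ fun s : ℝ => upd x k s) =
        (fun s : ℝ => ∫ t in (-w)..s, q (upd x k t)) := by
      funext s
      simp only [Function.comp]
      rw [upd_same]
      have : ∀ t, upd (upd x k s) k t = upd x k t := fun t =>
        upd_ext (fun j hj => upd_ne x hj s) t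
      simp only [this]
    rw [d4] at d2
    have := d2.unique d3
    rw [upd_self] at this
    rw [this]; simp [hq, hI]

lemma norm_sq_le_of_cube {d : ℕ} {w : ℝ} {x : EE d} (h : ∀ i, |x i| ≤ w) : ‖x‖ ^ 2 ≤ d * w ^ 2 := by
  rw [EuclideanSpace.norm_sq_eq]
  calc _ ≤ ∑ i : Fin d, w ^ 2 := Finset.sum_le_sum fun i _ => by
        rw [Real.norm_eq_abs]; exact pow_le_pow_left₀ (abs_nonneg _) (h i) 2
    _ = _ := by simp

lemma CV.compactSupport {d : ℕ} {w : ℝ} {h : EE d → ℝ} (hv : CV w h) : HasCompactSupport h := by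
  refine HasCompactSupport.of_support_subset_isCompact
    (isCompact_closedBall (0 : EE d) (1 + d * w ^ 2)) fun x hx => ?_
  rw [mem_closedBall_zero_iff]
  have : ‖x‖ ^ 2 ≤ d * w ^ 2 := norm_sq_le_of_cube fun i => by
    by_contra hc
    push Not at hc
    exact hx (hv x ⟨i, hc.le⟩)
  nlinarith [norm_nonneg x]

lemma integral_fderiv_zero {d : ℕ} {a : EE d → ℝ} (ha : ContDiff ℝ (⊤ : ℕ∞) a)
    (hc : HasCompactSupport a) (v : EE d) :
    Integrable (fun x => fderiv ℝ a x v) ∧ ∫ x, fderiv ℝ a x v = 0 := by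
  have hi : Integrable (fun x => fderiv ℝ a x v) :=
    (fderiv_apply_contDiff ha v).continuous.integrable_of_hasCompactSupport (hc.fderiv_apply ℝ v)
  refine ⟨hi, ?_⟩
  have := integral_mul_fderiv_eq_neg_fderiv_mul_of_integrable (μ := (volume : Measure (EE d)))
    (f := fun _ => (1:ℝ)) (g := a) (v := v) (𝕜 := ℝ) (by simp) (by simpa using hi)
    (by simpa using ha.continuous.integrable_of_hasCompactSupport hc) (by simp)
    (fun x _ => ha.differentiable (by simp) x)
  simpa using this

lemma cube_poincare {d : ℕ} {w : ℝ} (hw : 0 < w) {h : EE d → ℝ} (hs : ContDiff ℝ (⊤ : ℕ∞) h)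
    (hv : CV w h) (h0 : ∫ x, h x = 0) :
    ∃ a : Fin d → EE d → ℝ, (∀ i, ContDiff ℝ (⊤ : ℕ∞) (a i)) ∧ (∀ i, CV w (a i)) ∧
      ∀ x, h x = ∑ i, fderiv ℝ (a i) x (ee i) := by
  classical
  let b : ContDiffBump (0 : ℝ) := ⟨w / 4, w / 2, by positivity, by linarith⟩
  set β : ℝ → ℝ := b.normed volume with hβd
  have hβ : ContDiff ℝ (⊤ : ℕ∞) β := b.contDiff_normed
  have hβ0 : ∀ t, w ≤ |t| → β t = 0 := by
    intro t ht
    by_contra hc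
    have : t ∈ Function.support β := hc
    rw [hβd, b.support_normed_eq] at this
    simp only [Metric.mem_ball, dist_zero_right, Real.norm_eq_abs] at this
    have h2 : b.rOut = w / 2 := rfl
    linarith
  have hβ1 : ∫ t in (-w)..w, β t = 1 := by
    rw [intervalIntegral.integral_eq_integral_of_support_subset, hβd, b.integral_normed]
    intro t ht
    have : |t| < w := by
      by_contra hc
      exact ht (hβ0 t (not_lt.1 hc))
    rw [abs_lt] at this
    exact ⟨this.1, this.2.le⟩
  have key : ∀ s : Finset (Fin d), ∃ (a : Fin d → EE d → ℝ) (u : EE d → ℝ),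
      (∀ i, ContDiff ℝ (⊤ : ℕ∞) (a i)) ∧ (∀ i, CV w (a i)) ∧ ContDiff ℝ (⊤ : ℕ∞) u ∧
      (∀ x y, (∀ i, i ∉ s → x i = y i) → u x = u y) ∧
      CV w (fun x => (∏ i ∈ s, β (x i)) * u x) ∧
      ∀ x, h x = ∑ i ∈ s, fderiv ℝ (a i) x (ee i) + (∏ i ∈ s, β (x i)) * u x := by
    intro s
    induction s using Finset.induction_on with
    | empty =>
      refine ⟨fun _ _ => 0, h, fun _ => contDiff_const, fun _ _ _ => rfl, hs, fun x y hxy => ?_,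
        by simpa using hv, by simp⟩
      congr 1; ext i; exact hxy i (by simp)
    | insert k s hk ih =>
      obtain ⟨a, u, ha, hav, hu, hui, hrv, hr⟩ := ih
      have hrs : ContDiff ℝ (⊤ : ℕ∞) (fun x : EE d => (∏ i ∈ s, β (x i)) * u x) :=
        (contDiff_prod fun i _ => hβ.comp (coord_contDiff i)).mul hu
      obtain ⟨ak, hak, hakv, hv', he⟩ := cube_step hw hβ hβ0 hβ1 hrs hrv k
      have hI : ∀ x : EE d, β (x k) * (∫ t in (-w)..w, (∏ i ∈ s, β (upd x k t i)) * u (upd x k t))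
          = (∏ i ∈ insert k s, β (x i)) * ∫ t in (-w)..w, u (upd x k t) := by
        intro x
        rw [Finset.prod_insert hk, mul_assoc, ← intervalIntegral.integral_const_mul (∏ i ∈ s, β (x i))]
        congr 2
        funext t
        congr 1
        refine Finset.prod_congr rfl fun i hi => ?_
        rw [upd_ne]
        rintro rfl; exact hk hi
      simp only [hI] at hv' he
      refine ⟨Function.update a k ak, fun x => ∫ t in (-w)..w, u (upd x k t), ?_, ?_, ?_, ?_,
        hv', ?_⟩
      · intro i
        by_cases hi : i = k
        · subst hi; simpa using hak
        · simpa [Function.update_of_ne hi] using ha i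
      · intro i
        by_cases hi : i = k
        · subst hi; simpa using hakv
        · simpa [Function.update_of_ne hi] using hav i
      · exact pi_contDiff (k := fun p => u (upd p.1 k p.2)) (hu.comp (upd_contDiff k)) _ _
      · intro x y hxy
        have : ∀ t, u (upd x k t) = u (upd y k t) := by
          intro t
          refine hui _ _ fun i hi => ?_
          by_cases hik : i = k
          · subst hik; simp [upd_same]
          · rw [upd_ne _ hik, upd_ne _ hik]; exact hxy i (by simp [hik, hi])
        simp only [this]
      · intro x
        rw [hr x, he x, Finset.sum_insert hk, Function.update_self]
        have : ∑ i ∈ s, fderiv ℝ (Function.update a k ak i) x (ee i) =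
            ∑ i ∈ s, fderiv ℝ (a i) x (ee i) := by
          refine Finset.sum_congr rfl fun i hi => ?_
          rw [Function.update_of_ne]
          rintro rfl; exact hk hi
        rw [this]; ring
  obtain ⟨a, u, ha, hav, hu, hui, hrv, hr⟩ := key Finset.univ
  have huc : ∀ x, u x = u 0 := fun x => hui x 0 (by simp)
  refine ⟨a, ha, hav, ?_⟩
  have hB : Continuous (fun x : EE d => ∏ i, β (x i)) :=
    (contDiff_prod fun i _ => hβ.comp (coord_contDiff i) : ContDiff ℝ (⊤ : ℕ∞) _).continuous
  have hBc : CV w (fun x : EE d => ∏ i, β (x i)) := fun x ⟨i, hi⟩ =>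
    Finset.prod_eq_zero (Finset.mem_univ i) (hβ0 _ hi)
  have hBp : 0 < ∫ x : EE d, ∏ i, β (x i) := by
    refine hB.integral_pos_of_hasCompactSupport_nonneg_nonzero hBc.compactSupport
      (fun x => Finset.prod_nonneg fun i _ => b.nonneg_normed _) (x := 0) ?_
    refine Finset.prod_ne_zero_iff.2 fun i _ => ?_
    have : (0:ℝ) ∈ Function.support β := by
      rw [hβd, b.support_normed_eq]; simpa using b.rOut_pos
    simpa using this
  have hIntEq : ∫ x, h x = u 0 * ∫ x : EE d, ∏ i, β (x i) := by
    simp only [hr]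
    rw [integral_add, integral_finsetSum]
    · rw [Finset.sum_eq_zero fun i _ => (integral_fderiv_zero (ha i) (hav i).compactSupport _).2,
        zero_add, ← integral_const_mul]
      congr 1; funext x; rw [huc x, mul_comm]
    · exact fun i _ => (integral_fderiv_zero (ha i) (hav i).compactSupport _).1
    · exact integrable_finsetSum _
        fun i _ => (integral_fderiv_zero (ha i) (hav i).compactSupport _).1
    · exact (hB.mul hu.continuous).integrable_of_hasCompactSupport hrv.compactSupport
  have hu0 : u 0 = 0 := by
    rw [h0] at hIntEq
    rcases mul_eq_zero.1 hIntEq.symm with h | h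
    · exact h
    · exact absurd h hBp.ne'
  intro x
  rw [hr x, huc x, hu0]; simp

lemma sum_coord {d : ℕ} (x : EE d) : ∑ i, x i • (ee i : EE d) = x := by
  ext j
  simp [Finset.sum_apply, Pi.single_apply]

lemma ball_poincare {d : ℕ} {h : EE d → ℝ} (hs : ContDiff ℝ (⊤ : ℕ∞) h)
    (hv : ∀ x, 1 ≤ ‖x‖ → h x = 0) (h0 : ∫ x, h x = 0) :
    ∃ a : Fin d → EE d → ℝ, (∀ i, ContDiff ℝ (⊤ : ℕ∞) (a i)) ∧ (∀ i x, 1 ≤ ‖x‖ → a i x = 0) ∧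
      ∀ x, h x = ∑ i, fderiv ℝ (a i) x (ee i) := by
  have hd1 : (0:ℝ) < d + 1 := by positivity
  set L : ℝ := Real.log (d + 1) with hL
  have hL0 : 0 ≤ L := Real.log_nonneg (by linarith [(Nat.cast_nonneg d : (0:ℝ) ≤ d)])
  have hLe : Real.exp L = d + 1 := Real.exp_log hd1
  have hle : (1:ℝ) • (0 : EE d) = 0 := by simp
  set A : EE d → ℝ := fun x => mass 1 0 h x L with hA
  have hAs : ContDiff ℝ (⊤ : ℕ∞) A :=
    (mass_contDiff hs).comp (contDiff_id.prodMk (contDiff_const (c := L) (E := EE d)))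
  have hAv : ∀ x, 1 ≤ ‖x‖ → A x = 0 := by
    intro x hx
    simp only [hA, mass]
    rw [intervalIntegral.integral_congr (g := fun _ => (0:ℝ))]
    · simp
    · intro t ht
      rw [uIcc_of_le hL0] at ht
      have : h (phi 1 0 t x) = 0 := by
        apply hv
        simp only [phi, one_mul, smul_zero, add_zero, norm_smul, Real.norm_eq_abs, Real.abs_exp]
        have := Real.one_le_exp ht.1
        nlinarith
      simp [this]
  have hAd : ∀ x, fderiv ℝ A x x + d * A x = h ((d + 1 : ℝ) • x) * (d + 1 : ℝ) ^ d - h x := by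
    intro x
    have e0 : (fun t => A (phi 1 0 t x) * JJ d 1 t) =
        fun t => mass 1 0 h x (t + L) - mass 1 0 h x t := by
      funext t; exact mass_shift hle hs x t L
    have d1 : HasDerivAt (fun t => A (phi 1 0 t x)) (fderiv ℝ A x x) 0 := by
      have := phi_hasDerivAt (l := 1) (e := 0) hle 0 x
      have h2 := ((hAs.differentiable (by simp)) (phi 1 0 0 x)).hasFDerivAt.comp_hasDerivAt 0 this
      simp only [phi_zero, one_smul, add_zero] at h2
      exact h2
    have d2 : HasDerivAt (JJ d 1) (d : ℝ) 0 := by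
      have : HasDerivAt (fun t : ℝ => Real.exp (d * 1 * t)) (Real.exp (d * 1 * 0) * (d * 1 * 1)) 0 :=
        ((hasDerivAt_id (0:ℝ)).const_mul (d * 1 : ℝ)).exp
      have h3 := this.congr_deriv (g' := (d:ℝ)) (by simp)
      exact h3
    have d3 := d1.mul d2
    have d4 : HasDerivAt (fun t => mass 1 0 h x (t + L) - mass 1 0 h x t)
        (h (phi 1 0 (0 + L) x) * JJ d 1 (0 + L) - h (phi 1 0 0 x) * JJ d 1 0) 0 :=
      ((mass_hasDerivAt hs x (0 + L)).comp_add_const 0 L).sub (mass_hasDerivAt hs x 0)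
    have e1 : (fun t => A (phi 1 0 t x)) * JJ d 1 = (fun t => A (phi 1 0 t x) * JJ d 1 t) := rfl
    rw [e1, e0] at d3
    have := d3.unique d4
    simp only [phi_zero, JJ_zero, zero_add, mul_one] at this
    have e2 : JJ d 1 L = (d + 1 : ℝ) ^ d := by
      simp only [JJ, mul_one]; rw [Real.exp_nat_mul, hLe]
    have e3 : phi 1 0 L x = (d + 1 : ℝ) • x := by simp [phi, hLe]
    rw [e2, e3] at this
    linarith
  set hL' : EE d → ℝ := fun x => h ((d + 1 : ℝ) • x) * (d + 1 : ℝ) ^ d with hL'd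
  have hw : (0:ℝ) < 1 / (d + 1) := by positivity
  have s1 : ContDiff ℝ (⊤ : ℕ∞) hL' := (hs.comp (contDiff_const_smul _)).mul contDiff_const
  have s2 : CV (1 / (d + 1)) hL' := by
    rintro x ⟨i, hi⟩
    have : h ((d + 1 : ℝ) • x) = 0 := by
      apply hv
      rw [norm_smul, Real.norm_of_nonneg hd1.le]
      have h1 := PiLp.norm_apply_le x i
      rw [Real.norm_eq_abs] at h1
      rw [div_le_iff₀ hd1] at hi
      nlinarith
    simp [hL'd, this]
  have s3 : ∫ x, hL' x = 0 := by
    simp only [hL'd]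
    rw [integral_mul_const, Measure.integral_comp_smul, h0]; simp
  obtain ⟨b, hb, hbv, hbe⟩ := cube_poincare hw s1 s2 s3
  refine ⟨fun i x => b i x - x i * A x, fun i => (hb i).sub ((coord_contDiff i).mul hAs), ?_, ?_⟩
  · intro i x hx
    have : b i x = 0 := by
      apply hbv
      by_contra hc
      push Not at hc
      have := norm_sq_le_of_cube fun i => (hc i).le
      have h2 : (d:ℝ) * (1 / (d + 1)) ^ 2 < 1 := by
        rw [div_pow, one_pow, mul_one_div, div_lt_one (by positivity)]
        nlinarith [(Nat.cast_nonneg d : (0:ℝ) ≤ d)]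
      nlinarith
    simp [this, hAv x hx]
  · intro x
    have e1 : ∀ i, fderiv ℝ (fun x : EE d => b i x - x i * A x) x (ee i) =
        fderiv ℝ (b i) x (ee i) - (x i * fderiv ℝ A x (ee i) + A x) := by
      intro i
      have hc : HasFDerivAt (fun x : EE d => x i) (EuclideanSpace.proj i : EE d →L[ℝ] ℝ) x :=
        (EuclideanSpace.proj i : EE d →L[ℝ] ℝ).hasFDerivAt
      have := (((hb i).differentiable (by simp)) x).hasFDerivAt.sub
        (hc.mul ((hAs.differentiable (by simp)) x).hasFDerivAt)
      have h2 : (fun x : EE d => b i x - x i * A x) = (b i - (fun x : EE d => x i) * A) := rfl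
      rw [h2, this.fderiv]
      simp
    have e2 : ∑ i, x i * fderiv ℝ A x (ee i) = fderiv ℝ A x x := by
      conv_rhs => rw [← sum_coord x, map_sum]
      simp only [map_smul, smul_eq_mul, sum_coord]
    simp only [e1]
    rw [Finset.sum_sub_distrib, Finset.sum_add_distrib, e2, ← hbe x]
    have := hAd x
    simp only [Finset.sum_const, Finset.card_univ, Fintype.card_fin, nsmul_eq_mul]
    simp only [hL'd]
    linarith

lemma step2 {d : ℕ} {f : EE d → ℝ} {c : ℝ} (hf : ContDiff ℝ (⊤ : ℕ∞) f) (hp : ∀ x, 0 < f x)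
    (hc : 0 < c) (hv : ∀ x, 1 ≤ ‖x‖ → f x = c) (h0 : ∫ x, (c - f x) = 0) :
    Tr f (fun _ => c) := by
  obtain ⟨a, ha, hav, he⟩ := ball_poincare (h := fun x => c - f x) (contDiff_const.sub hf)
    (fun x hx => by simp [hv x hx]) h0
  have := stepB ha hav hf hp (fun x => by rw [← he x]; simpa using hc)
  simp only [← he] at this
  simpa using this

noncomputable def radInt {d : ℕ} (g : EE d → ℝ) (x : EE d) : ℝ :=
  ∫ t in (0:ℝ)..1, g (t • x) * t ^ (d - 1)

lemma radInt_contDiff {d : ℕ} {g : EE d → ℝ} (hg : ContDiff ℝ (⊤ : ℕ∞) g) :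
    ContDiff ℝ (⊤ : ℕ∞) (radInt g) := by
  refine pi_contDiff (k := fun p : EE d × ℝ => g (p.2 • p.1) * p.2 ^ (d - 1)) ?_ 0 1
  exact (hg.comp (contDiff_snd.smul contDiff_fst)).mul (contDiff_snd.pow _)

lemma radInt_div {d : ℕ} (hd : 1 ≤ d) {g : EE d → ℝ} (hg : ContDiff ℝ (⊤ : ℕ∞) g) (x : EE d) :
    fderiv ℝ (radInt g) x x + d * radInt g x = g x := by
  have e0 : ∀ s : ℝ, radInt g (s • x) * s ^ d = ∫ u in (0:ℝ)..s, g (u • x) * u ^ (d - 1) := by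
    intro s
    have := intervalIntegral.smul_integral_comp_mul_left (a := 0) (b := 1)
      (fun u => g (u • x) * u ^ (d - 1)) s
    rw [mul_zero, mul_one] at this
    rw [← this, radInt, smul_eq_mul, ← intervalIntegral.integral_mul_const,
      ← intervalIntegral.integral_const_mul]
    congr 1; funext t
    rw [smul_smul, mul_comm t s, mul_pow]
    obtain ⟨n, rfl⟩ : ∃ n, d = n + 1 := ⟨d - 1, by omega⟩
    simp only [Nat.add_sub_cancel]; ring
  have hsm := radInt_contDiff hg
  have d1 : HasDerivAt (fun s : ℝ => radInt g (s • x)) (fderiv ℝ (radInt g) x x) 1 := by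
    have h1 : HasDerivAt (fun s : ℝ => s • x) ((1:ℝ) • x) 1 := (hasDerivAt_id (1:ℝ)).smul_const x
    have h2 := ((hsm.differentiable (by simp)) ((1:ℝ) • x)).hasFDerivAt.comp_hasDerivAt 1 h1
    simp only [one_smul] at h2
    exact h2
  have d2 : HasDerivAt (fun s : ℝ => s ^ d) (d:ℝ) 1 := by
    simpa using hasDerivAt_pow d (1:ℝ)
  have hc : Continuous (fun u : ℝ => g (u • x) * u ^ (d - 1)) := by
    have := hg.continuous
    fun_prop
  have d3 : HasDerivAt (fun s : ℝ => ∫ u in (0:ℝ)..s, g (u • x) * u ^ (d - 1))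
      (g ((1:ℝ) • x) * 1 ^ (d - 1)) 1 :=
    intervalIntegral.integral_hasDerivAt_right (hc.intervalIntegrable _ _)
        (hc.stronglyMeasurableAtFilter _ _) hc.continuousAt
  have d4 := d1.fun_mul d2
  simp only [e0] at d4
  have := d4.unique d3
  simp only [one_smul, one_pow, mul_one] at this
  linarith

lemma rad_solvable {d : ℕ} (hd : 1 ≤ d) {a f0 f1 : EE d → ℝ} (ha : ContDiff ℝ (⊤ : ℕ∞) a)
    (h0 : ContDiff ℝ (⊤ : ℕ∞) f0) (h1 : ContDiff ℝ (⊤ : ℕ∞) f1) (p0 : ∀ x, 0 < f0 x)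
    {m : ℝ} (hm : 0 < m) (p1 : ∀ x, m ≤ f1 x) (hD : DivEq 1 0 a f0 f1) : Solvable 1 0 f1 a := by
  have hle : (1:ℝ) • (0 : EE d) = 0 := by simp
  intro x
  constructor
  · refine ⟨|a x| / m, ?_⟩
    have hS : 0 ≤ |a x| / m := by positivity
    have : ∫ s in (0:ℝ)..(|a x| / m), m ≤ mass 1 0 f1 x (|a x| / m) := by
      refine intervalIntegral.integral_mono_on hS (by simp)
        ((kk_cont h1 x).intervalIntegrable _ _) fun s hs => ?_
      have h2 : 1 ≤ JJ d 1 s := Real.one_le_exp (by have := hs.1; positivity)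
      nlinarith [p1 (phi 1 0 s x)]
    rw [intervalIntegral.integral_const, sub_zero, smul_eq_mul, div_mul_cancel₀ _ hm.ne'] at this
    exact (le_abs_self _).trans this
  · have hmono := mass_strictMono (l := 1) (e := 0) h0 p0 x
    have hneg : mass 1 0 f0 x (-1) < 0 := by
      have := hmono (show (-1:ℝ) < 0 by norm_num)
      rwa [mass_zero] at this
    have ht : Tendsto (fun S => a (phi 1 0 S x) * JJ d 1 S) atBot (𝓝 (a ((0:ℝ) • x) * 0)) := by
      refine Tendsto.mul ?_ ?_
      · refine (ha.continuous.tendsto _).comp (f := fun S => phi 1 0 S x) ?_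
        have e1 : (fun S => phi 1 0 S x) = fun S : ℝ => Real.exp S • x := by
          funext S; simp [phi]
        rw [e1]
        exact Real.tendsto_exp_atBot.smul_const x
      · have e1 : JJ d 1 = fun S : ℝ => Real.exp (d * S) := by
          funext S; simp [JJ]
        rw [e1]
        refine Real.tendsto_exp_atBot.comp ?_
        exact tendsto_id.const_mul_atBot (by exact_mod_cast hd)
    rw [mul_zero] at ht
    obtain ⟨S, hS1, hS2⟩ := ((ht.eventually (lt_mem_nhds hneg)).and (eventually_le_atBot (-1))).exists
    refine ⟨S, ?_⟩
    have := a_flow hle ha h0 h1 hD x S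
    have := hmono.monotone hS2
    linarith

lemma rad_step {d : ℕ} (hd : 1 ≤ d) {f0 f1 : EE d → ℝ}
    (h0 : ContDiff ℝ (⊤ : ℕ∞) f0) (h1 : ContDiff ℝ (⊤ : ℕ∞) f1)
    {m : ℝ} (hm : 0 < m) (p0 : ∀ x, m ≤ f0 x) (p1 : ∀ x, m ≤ f1 x)
    (hs : ∀ x, ‖x‖ = 1 → radInt (fun x => f0 x - f1 x) x = 0) : Tr f1 f0 := by
  have hle : (1:ℝ) • (0 : EE d) = 0 := by simp
  set a := radInt (fun x => f0 x - f1 x) with had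
  have ha : ContDiff ℝ (⊤ : ℕ∞) a := radInt_contDiff (h0.sub h1)
  have hD : DivEq 1 0 a f0 f1 := fun x => by
    simpa using radInt_div hd (h0.sub h1) x
  have hD' : DivEq 1 0 (fun x => - a x) f1 f0 := fun x => by
    have := hD x
    rw [fderiv_fun_neg]
    simp only [neg_apply]
    linarith
  have q0 : ∀ x, 0 < f0 x := fun x => hm.trans_le (p0 x)
  have q1 : ∀ x, 0 < f1 x := fun x => hm.trans_le (p1 x)
  obtain ⟨τ, hτ, hτ2, hG, hdet⟩ := transport hle ha h0 h1 q0 q1 hD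
    (rad_solvable hd ha h0 h1 q0 hm p1 hD) (rad_solvable hd ha.neg h1 h0 q1 hm p0 hD')
  have key : ∀ x, ‖phi 1 0 (τ x) x‖ ≤ 1 ↔ ‖x‖ ≤ 1 := by
    intro x
    by_cases hx : x = 0
    · simp [hx, phi]
    have hn : 0 < ‖x‖ := norm_pos_iff.2 hx
    set u : EE d := ‖x‖⁻¹ • x with hu
    have hun : ‖u‖ = 1 := by rw [hu, norm_smul, norm_inv, norm_norm, inv_mul_cancel₀ hn.ne']
    have hxu : phi 1 0 (Real.log ‖x‖) u = x := by
      simp [phi, Real.exp_log hn, hu, smul_smul, mul_inv_cancel₀ hn.ne']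
    have e := hτ2 u (Real.log ‖x‖)
    rw [hs u hun, zero_add, hxu] at e
    have e2 : phi 1 0 (τ x) x = phi 1 0 (Real.log ‖x‖ + τ x) u := by
      conv_lhs => rw [← hxu, phi_add hle, hxu, add_comm]
    have e3 : ‖phi 1 0 (τ x) x‖ = Real.exp (Real.log ‖x‖ + τ x) := by
      rw [e2]; simp [phi, norm_smul, hun]
    have m0 := mass_strictMono (l := 1) (e := 0) h0 q0 u
    have m1 := mass_strictMono (l := 1) (e := 0) h1 q1 u
    rw [e3, Real.exp_le_one_iff, ← m1.le_iff_le, e, mass_zero, ← mass_zero (l := 1) (e := 0) f0 u,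
      m0.le_iff_le, Real.log_nonpos_iff hn.le]
  refine ⟨_, hG, ?_, hdet⟩
  ext y
  simp only [Set.mem_image, mem_closedBall_zero_iff]
  constructor
  · rintro ⟨x, hx, rfl⟩
    exact (key x).2 hx
  · intro hy
    obtain ⟨x, rfl⟩ := hG.bij.2 y
    exact ⟨x, (key x).1 hy, rfl⟩

lemma Tr.integral {d : ℕ} {f g : EE d → ℝ} (h : Tr f g) :
    ∫ x in Metric.closedBall (0 : EE d) 1, g x = ∫ x in Metric.closedBall (0 : EE d) 1, f x := by
  obtain ⟨G, hG, hB, he⟩ := h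
  have := integral_image_eq_integral_abs_det_fderiv_smul (volume : Measure (EE d))
    (s := Metric.closedBall (0 : EE d) 1) (f := G) (f' := fun x => fderiv ℝ G x)
    measurableSet_closedBall (fun x _ => (hG.diff x).hasFDerivAt.hasFDerivWithinAt)
    hG.bij.1.injOn f
  rw [hB] at this
  rw [this]
  congr 1; funext x
  rw [he, smul_eq_mul, mul_comm]

lemma step1 {d : ℕ} (hd : 1 ≤ d) {f : EE d → ℝ} (hf : ContDiff ℝ (⊤ : ℕ∞) f)
    {m : ℝ} (hm : 0 < m) (p : ∀ x, m ≤ f x) : ∃ c : ℝ, 0 < c ∧ Tr f (fun _ => c) := by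
  set B := Metric.closedBall (0 : EE d) 1 with hB
  set V := (volume : Measure (EE d)).real B with hV
  have hV0 : 0 < V := by
    have h1 : 0 < (volume : Measure (EE d)) B := Metric.measure_closedBall_pos _ _ one_pos
    exact ENNReal.toReal_pos h1.ne' measure_closedBall_lt_top.ne
  have hfi : IntegrableOn f B := hf.continuous.continuousOn.integrableOn_compact
    (isCompact_closedBall _ _)
  set c := (∫ x in B, f x) / V with hcd
  have hcV : ∫ x in B, f x = c * V := by rw [hcd, div_mul_cancel₀ _ hV0.ne']
  have hci : ∀ c : ℝ, IntegrableOn (fun _ : EE d => c) B := fun c =>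
    continuous_const.continuousOn.integrableOn_compact (isCompact_closedBall _ _)
  have hc : 0 < c := by
    have : ∫ x in B, m ≤ ∫ x in B, f x := integral_mono (hci m) hfi p
    rw [setIntegral_const, smul_eq_mul, ← hV] at this
    exact div_pos (lt_of_lt_of_le (by positivity) this) hV0
  -- cutoffs
  set κ : ℝ → ℝ := fun ρ => Real.smoothTransition (16 * ρ - 1) * Real.smoothTransition (2 - 4 * ρ)
    with hκd
  have hκs : ContDiff ℝ (⊤ : ℕ∞) κ :=
    (Real.smoothTransition.contDiff.comp (by fun_prop)).mul
      (Real.smoothTransition.contDiff.comp (by fun_prop))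
  have hκ0 : ∀ ρ, 0 ≤ κ ρ := fun ρ =>
    mul_nonneg (Real.smoothTransition.nonneg _) (Real.smoothTransition.nonneg _)
  have hκ1 : ∀ ρ, κ ρ ≤ 1 := fun ρ =>
    mul_le_one₀ (Real.smoothTransition.le_one _) (Real.smoothTransition.nonneg _)
      (Real.smoothTransition.le_one _)
  have hκa : ∀ ρ, ρ ≤ 1 / 16 → κ ρ = 0 := fun ρ h => by
    simp only [hκd]; rw [Real.smoothTransition.zero_of_nonpos (by linarith), zero_mul]
  have hκb : ∀ ρ, 1 ≤ ρ → κ ρ = 0 := fun ρ h => by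
    simp only [hκd]
    rw [Real.smoothTransition.zero_of_nonpos (x := 2 - 4 * ρ) (by linarith), mul_zero]
  set k0 := ∫ t in (0:ℝ)..1, κ (t ^ 2) * t ^ (d - 1) with hk0
  have hk0p : 0 < k0 := by
    refine intervalIntegral.integral_pos one_pos ?_ ?_ ⟨1 / 2, by norm_num, ?_⟩
    · have := hκs.continuous
      exact Continuous.continuousOn (by fun_prop)
    · intro t ht
      have := ht.1
      exact mul_nonneg (hκ0 _) (by positivity)
    · refine mul_pos (mul_pos ?_ ?_) (by positivity)
      · exact Real.smoothTransition.pos_of_pos (by norm_num)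
      · exact Real.smoothTransition.pos_of_pos (by norm_num)
  obtain ⟨C, hC⟩ := (isCompact_closedBall (0 : EE d) 1).exists_bound_of_continuousOn
    (f := fun x => c - f x) (continuous_const.sub hf.continuous).continuousOn
  have hC0 : 0 ≤ C := (norm_nonneg _).trans (hC 0 (by simp))
  set μ := min m c with hμ
  have hμ0 : 0 < μ := lt_min hm hc
  obtain ⟨η, hη0, hη1, hη2⟩ : ∃ η : ℝ, 0 < η ∧ η < 1 ∧ C * η / k0 ≤ μ / 2 := by
    refine ⟨min (1 / 2) (μ * k0 / (2 * (C + 1))), lt_min (by norm_num) (by positivity),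
      (min_le_left _ _).trans_lt (by norm_num), ?_⟩
    rw [div_le_iff₀ hk0p]
    calc C * min (1 / 2) (μ * k0 / (2 * (C + 1))) ≤ (C + 1) * (μ * k0 / (2 * (C + 1))) := by
          apply mul_le_mul (by linarith) (min_le_right _ _) _ (by linarith)
          exact le_min (by norm_num) (by positivity)
      _ = μ / 2 * k0 := by field_simp
  set w := 1 - (1 - η) ^ 2 with hw
  have hw0 : 0 < w := by rw [hw]; nlinarith
  set χ : EE d → ℝ := fun x => Real.smoothTransition ((‖x‖ ^ 2 - (1 - η) ^ 2) / w) with hχd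
  have hχs : ContDiff ℝ (⊤ : ℕ∞) χ := by
    refine Real.smoothTransition.contDiff.comp ?_
    exact ((contDiff_norm_sq ℝ).sub contDiff_const).div_const _
  have hχ1 : ∀ x, 1 ≤ ‖x‖ → χ x = 1 := fun x hx => by
    apply Real.smoothTransition.one_of_one_le
    rw [le_div_iff₀ hw0, hw]; nlinarith
  have hχ0 : ∀ x, ‖x‖ ≤ 1 - η → χ x = 0 := fun x hx => by
    apply Real.smoothTransition.zero_of_nonpos
    apply div_nonpos_of_nonpos_of_nonneg _ hw0.le
    nlinarith [norm_nonneg x]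
  have hχm : ∀ x, 0 ≤ χ x ∧ χ x ≤ 1 := fun x =>
    ⟨Real.smoothTransition.nonneg _, Real.smoothTransition.le_one _⟩
  set g : EE d → ℝ := fun x => χ x * (c - f x) with hg
  have hgs : ContDiff ℝ (⊤ : ℕ∞) g := hχs.mul (contDiff_const.sub hf)
  have hgi : ∀ x : EE d, Continuous (fun t : ℝ => g (t • x) * t ^ (d - 1)) := fun x => by
    have := hgs.continuous
    fun_prop
  have hbb : ∀ x, ‖x‖ = 1 → |radInt g x| ≤ C * η := by
    intro x hx
    have hnt : ∀ t : ℝ, 0 ≤ t → ‖t • x‖ = t := fun t ht => by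
      rw [norm_smul, hx, mul_one, Real.norm_of_nonneg ht]
    rw [radInt, ← intervalIntegral.integral_add_adjacent_intervals (b := 1 - η)
      ((hgi x).intervalIntegrable _ _) ((hgi x).intervalIntegrable _ _)]
    have e1 : ∫ t in (0:ℝ)..(1 - η), g (t • x) * t ^ (d - 1) = 0 := by
      rw [intervalIntegral.integral_congr (g := fun _ => (0:ℝ))]
      · simp
      · intro t ht
        rw [uIcc_of_le (by linarith)] at ht
        have : χ (t • x) = 0 := hχ0 _ (by rw [hnt t ht.1]; exact ht.2)
        simp [hg, this]
    rw [e1, zero_add]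
    have := intervalIntegral.norm_integral_le_of_norm_le_const (a := 1 - η) (b := 1) (C := C)
      (f := fun t => g (t • x) * t ^ (d - 1)) (fun t ht => ?_)
    · rw [Real.norm_eq_abs] at this
      rwa [show |1 - (1 - η)| = η by rw [sub_sub_cancel, abs_of_pos hη0]] at this
    · rw [uIoc_of_le (by linarith)] at ht
      have ht0 : 0 ≤ t := by linarith [ht.1]
      have h1 := hC (t • x) (by rw [mem_closedBall_zero_iff, hnt t ht0]; exact ht.2)
      rw [norm_mul, hg]
      simp only [norm_mul]
      have h2 : ‖χ (t • x)‖ ≤ 1 := by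
        rw [Real.norm_of_nonneg (hχm _).1]; exact (hχm _).2
      have h3 : ‖t ^ (d - 1)‖ ≤ 1 := by
        rw [norm_pow, Real.norm_of_nonneg ht0]; exact pow_le_one₀ ht0 ht.2
      calc _ ≤ 1 * C * 1 := by gcongr
        _ = C := by ring
  set q : EE d → ℝ := fun x => κ (‖x‖ ^ 2) * (-(radInt g (‖x‖⁻¹ • x)) / k0) with hq
  have hqs : ContDiff ℝ (⊤ : ℕ∞) q := by
    rw [contDiff_iff_contDiffAt]
    intro x
    by_cases hx : x = 0
    · have : q =ᶠ[𝓝 x] fun _ => 0 := by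
        subst hx
        filter_upwards [Metric.ball_mem_nhds (0 : EE d) (show (0:ℝ) < 1 / 4 by norm_num)] with y hy
        rw [mem_ball_zero_iff] at hy
        simp only [hq]
        rw [hκa _ (by nlinarith [norm_nonneg y]), zero_mul]
      exact contDiffAt_const.congr_of_eventuallyEq this
    · refine ContDiffAt.mul ?_ (ContDiffAt.div_const (ContDiffAt.neg ?_) _)
      · exact (hκs.comp (contDiff_norm_sq ℝ)).contDiffAt
      · refine (radInt_contDiff hgs).contDiffAt.comp x ?_
        exact ((contDiffAt_norm ℝ hx).inv (norm_ne_zero_iff.2 hx)).smul contDiffAt_id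
  have hqb : ∀ x, -(μ / 2) ≤ q x := by
    intro x
    by_cases hx : x = 0
    · have : q x = 0 := by simp only [hq]; rw [hκa _ (by simp [hx]), zero_mul]
      rw [this]; linarith
    · have hn : 0 < ‖x‖ := norm_pos_iff.2 hx
      have h1 := hbb (‖x‖⁻¹ • x) (by rw [norm_smul, norm_inv, norm_norm, inv_mul_cancel₀ hn.ne'])
      apply neg_le_of_abs_le
      simp only [hq]
      rw [abs_mul, abs_div, abs_neg, abs_of_pos hk0p, abs_of_nonneg (hκ0 _)]
      refine le_trans ?_ hη2
      calc _ ≤ 1 * (|radInt g (‖x‖⁻¹ • x)| / k0) := by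
            gcongr; exact hκ1 _
        _ ≤ _ := by rw [one_mul]; gcongr
  set f0 : EE d → ℝ := fun x => f x + g x + q x with hf0
  have hf0s : ContDiff ℝ (⊤ : ℕ∞) f0 := (hf.add hgs).add hqs
  have hf0p : ∀ x, μ / 2 ≤ f0 x := by
    intro x
    have h1 := hqb x
    have h2 : μ ≤ f x + g x := by
      simp only [hg]
      have := hχm x
      have h3 : μ ≤ f x := (min_le_left _ _).trans (p x)
      have h4 : μ ≤ c := min_le_right _ _
      nlinarith
    simp only [hf0]; linarith
  have hf0c : ∀ x, 1 ≤ ‖x‖ → f0 x = c := by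
    intro x hx
    simp only [hf0, hg, hq]
    rw [hχ1 x hx, hκb _ (by nlinarith)]; ring
  have hT : Tr f f0 := by
    refine rad_step hd hf0s hf (half_pos hμ0) hf0p
      (fun x => ((half_le_self hμ0.le).trans (min_le_left _ _)).trans (p x)) fun x hx => ?_
    have e1 : ∀ t : ℝ, t ∈ uIcc (0:ℝ) 1 → (f0 (t • x) - f (t • x)) * t ^ (d - 1) =
        g (t • x) * t ^ (d - 1) + κ (t ^ 2) * t ^ (d - 1) * (-(radInt g x) / k0) := by
      intro t ht
      rw [uIcc_of_le zero_le_one] at ht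
      have hnt : ‖t • x‖ = t := by
        rw [norm_smul, hx, mul_one, Real.norm_of_nonneg ht.1]
      simp only [hf0, hq, hnt]
      rcases eq_or_lt_of_le ht.1 with h | h
      · rw [← h, hκa _ (by norm_num)]; ring
      · rw [smul_smul, inv_mul_cancel₀ h.ne', one_smul]; ring
    rw [radInt, intervalIntegral.integral_congr e1, intervalIntegral.integral_add,
      intervalIntegral.integral_mul_const, ← hk0]
    · rw [← radInt]; field_simp; ring
    · exact (hgi x).intervalIntegrable _ _
    · have := hκs.continuous
      exact Continuous.intervalIntegrable (by fun_prop) _ _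
  refine ⟨c, hc, hT.trans (step2 hf0s (fun x => (half_pos hμ0).trans_le (hf0p x)) hc hf0c ?_)⟩
  rw [← setIntegral_eq_integral_of_forall_compl_eq_zero (s := B), integral_sub (hci c),
    hT.integral, hcV, setIntegral_const, ← hV, smul_eq_mul]
  · ring
  · exact hf0s.continuous.continuousOn.integrableOn_compact (isCompact_closedBall _ _)
  · intro x hx
    rw [hB, mem_closedBall_zero_iff, not_le] at hx
    rw [hf0c x hx.le, sub_self]

lemma det_mul_clm {d : ℕ} (A B : EE d →L[ℝ] EE d) : (A * B).det = A.det * B.det :=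
  LinearMap.det_comp _ _

lemma det_ne_of_isUnit {d : ℕ} {A : EE d →L[ℝ] EE d} (h : IsUnit A) : A.det ≠ 0 := by
  obtain ⟨u, rfl⟩ := h
  have h1 : ((u : EE d →L[ℝ] EE d) * (u⁻¹ : (EE d →L[ℝ] EE d)ˣ)).det = 1 := by
    rw [Units.mul_inv]; simp [ContinuousLinearMap.det]
  have h2 : ((u : EE d →L[ℝ] EE d) * (u⁻¹ : (EE d →L[ℝ] EE d)ˣ)).det =
    (u : EE d →L[ℝ] EE d).det * ((u⁻¹ : (EE d →L[ℝ] EE d)ˣ) : EE d →L[ℝ] EE d).det :=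
    det_mul_clm _ _
  rw [h2] at h1
  exact left_ne_zero_of_mul_eq_one h1

lemma det_continuous {d : ℕ} : Continuous (fun A : EE d →L[ℝ] EE d => A.det) :=
  ContinuousLinearMap.continuous_det

lemma diffeo_of_small {d : ℕ} {u : EE d → EE d} (hu : ContDiff ℝ (⊤ : ℕ∞) u)
    (hb : ∀ x, ‖fderiv ℝ u x‖ ≤ 1 / 2) {R : ℝ} (hR : ∀ x, R < ‖x‖ → fderiv ℝ u x = 0) :
    IsSmoothDiffeo (fun x => x + u x) ∧
      ∃ m : ℝ, 0 < m ∧ ∀ x, m ≤ |(fderiv ℝ (fun x => x + u x) x).det| := by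
  have hs : ContDiff ℝ (⊤ : ℕ∞) (fun x => x + u x) := contDiff_id.add hu
  have hud : Differentiable ℝ u := hu.differentiable (by simp)
  have hfd : ∀ x, fderiv ℝ (fun x => x + u x) x = 1 + fderiv ℝ u x := fun x => by
    have : HasFDerivAt (fun x => x + u x) (ContinuousLinearMap.id ℝ (EE d) + fderiv ℝ u x) x :=
      (hasFDerivAt_id x).add (hud x).hasFDerivAt
    exact this.fderiv
  have hunit : ∀ x, IsUnit (1 + fderiv ℝ u x) := fun x => by
    have := isUnit_one_sub_of_norm_lt_one (x := -fderiv ℝ u x) (by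
      rw [norm_neg]; exact (hb x).trans_lt (by norm_num))
    simpa using this
  constructor
  · refine ⟨hs, ?_⟩
    have hap : ApproximatesLinearOn (fun x => x + u x)
        ((ContinuousLinearEquiv.refl ℝ (EE d) : EE d ≃L[ℝ] EE d) : EE d →L[ℝ] EE d) univ (1 / 2) := by
      intro x _ y _
      have := convex_univ.norm_image_sub_le_of_norm_hasFDerivWithin_le (𝕜 := ℝ) (f := u)
        (f' := fun x => fderiv ℝ u x)
        (fun x _ => (hud x).hasFDerivAt.hasFDerivWithinAt) (fun x _ => hb x) (mem_univ y) (mem_univ x)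
      convert this using 2
      · simp; abel
      · norm_num
    let Φ := hap.toHomeomorph _ (by
      rcases subsingleton_or_nontrivial (EE d) with h | h
      · exact Or.inl h
      · right
        have : ‖((ContinuousLinearEquiv.refl ℝ (EE d)).symm : EE d →L[ℝ] EE d)‖₊ = 1 := by
          ext; exact ContinuousLinearMap.norm_id
        rw [this]; norm_num)
    have hΦ : ∀ x, Φ x = x + u x := fun x => rfl
    refine ⟨Φ.symm, ?_, fun x => Φ.symm_apply_apply x, fun x => Φ.apply_symm_apply x⟩
    refine Φ.contDiff_symm (f₀' := fun x => ContinuousLinearEquiv.unitsEquiv ℝ (EE d) (hunit x).unit)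
      (fun x => ?_) hs
    have h1 : HasFDerivAt (fun x => x + u x) (1 + fderiv ℝ u x) x := by
      rw [← hfd]; exact (hs.differentiable (by simp) x).hasFDerivAt
    exact h1
  · have hne : ∀ x, (1 + fderiv ℝ u x).det ≠ 0 := fun x => det_ne_of_isUnit (hunit x)
    have hcont : Continuous (fun x => |(1 + fderiv ℝ u x).det|) :=
      (det_continuous.comp (continuous_const.add (hu.continuous_fderiv (by simp)))).abs
    obtain ⟨x0, -, hx0⟩ := (isCompact_closedBall (0 : EE d) |R|).exists_isMinOn ⟨0, by simp⟩
      hcont.continuousOn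
    refine ⟨min 1 |(1 + fderiv ℝ u x0).det|, lt_min one_pos (abs_pos.2 (hne _)), fun x => ?_⟩
    rw [hfd]
    by_cases hx : ‖x‖ ≤ |R|
    · exact (min_le_right _ _).trans (hx0 (by simpa using hx))
    · rw [hR x ((le_abs_self R).trans_lt (not_le.1 hx))]
      refine (min_le_left _ _).trans ?_
      simp [ContinuousLinearMap.det]

noncomputable def Ft {d : ℕ} (F : EE d → EE d) (t : ℝ) (x : EE d) : EE d :=
  if t = 0 then fderiv ℝ F 0 x else t⁻¹ • F (t • x)

section ft
variable {d : ℕ} {F H : EE d → EE d}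

lemma Ft_contDiff (hF : ContDiff ℝ (⊤ : ℕ∞) F) (t : ℝ) : ContDiff ℝ (⊤ : ℕ∞) (Ft F t) := by
  by_cases ht : t = 0
  · have : Ft F t = fun x => fderiv ℝ F 0 x := by funext x; simp [Ft, ht]
    rw [this]; exact (fderiv ℝ F 0).contDiff
  · have : Ft F t = fun x => t⁻¹ • F (t • x) := by funext x; simp [Ft, ht]
    rw [this]
    exact (hF.comp (contDiff_const_smul t)).const_smul _

lemma Ft_hasFDerivAt (hF : ContDiff ℝ (⊤ : ℕ∞) F) (t : ℝ) (x : EE d) :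
    HasFDerivAt (Ft F t) (fderiv ℝ F (t • x)) x := by
  by_cases ht : t = 0
  · have : Ft F t = fun x => fderiv ℝ F 0 x := by funext x; simp [Ft, ht]
    rw [this, ht, zero_smul]; exact (fderiv ℝ F 0).hasFDerivAt
  · have : Ft F t = fun x => t⁻¹ • F (t • x) := by funext x; simp [Ft, ht]
    rw [this]
    have h1 : HasFDerivAt (fun x : EE d => t • x) (t • ContinuousLinearMap.id ℝ (EE d)) x :=
      (hasFDerivAt_id x).const_smul t
    have h2 := ((hF.differentiable (by simp) (t • x)).hasFDerivAt.comp x h1).const_smul t⁻¹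
    refine h2.congr_fderiv ?_
    ext1 v
    simp [smul_smul, inv_mul_cancel₀ ht]

lemma Ft_zero (h0 : F 0 = 0) (t : ℝ) : Ft F t 0 = 0 := by simp [Ft, h0]

lemma Ft_inv (hF : ContDiff ℝ (⊤ : ℕ∞) F) (hH : ContDiff ℝ (⊤ : ℕ∞) H) (hr : ∀ x, F (H x) = x)
    (h0 : H 0 = 0) (t : ℝ) (x : EE d) : Ft F t (Ft H t x) = x := by
  by_cases ht : t = 0
  · simp only [Ft, ht, if_true]
    have h1 := ((hF.differentiable (by simp) (H 0)).hasFDerivAt.comp 0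
      (hH.differentiable (by simp) 0).hasFDerivAt)
    have h2 : F ∘ H = id := funext hr
    rw [h2] at h1
    have := h1.unique (hasFDerivAt_id _)
    rw [h0] at this
    have h3 := congrArg (fun L : EE d →L[ℝ] EE d => L x) this
    simpa using h3
  · simp only [Ft, ht, if_false]
    rw [smul_smul, mul_inv_cancel₀ ht, one_smul, hr, smul_smul, inv_mul_cancel₀ ht, one_smul]

lemma Ft_bound (hF : ContDiff ℝ (⊤ : ℕ∞) F) (h0 : F 0 = 0) (r : ℝ) (hr : 0 ≤ r) :
    ∃ M, 0 < M ∧ ∀ t ∈ Icc (0:ℝ) 1, ∀ x, ‖x‖ ≤ r → ‖Ft F t x‖ ≤ M := by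
  obtain ⟨C, hC⟩ := (isCompact_closedBall (0 : EE d) r).exists_bound_of_continuousOn
    (f := fun x => fderiv ℝ F x) (hF.continuous_fderiv (by simp)).continuousOn
  have hC0 : 0 ≤ C := (norm_nonneg _).trans (hC 0 (by simpa using hr))
  refine ⟨C * r + 1, by positivity, fun t ht x hx => ?_⟩
  have := (convex_closedBall (0 : EE d) r).norm_image_sub_le_of_norm_hasFDerivWithin_le (𝕜 := ℝ)
    (f := Ft F t) (f' := fun x => fderiv ℝ F (t • x)) (C := C) (x := 0) (y := x)
    (fun x _ => (Ft_hasFDerivAt hF t x).hasFDerivWithinAt) (fun y hy => hC _ (by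
      rw [mem_closedBall_zero_iff] at hy ⊢
      rw [norm_smul, Real.norm_of_nonneg ht.1]
      nlinarith [ht.2, norm_nonneg y, ht.1])) (by simpa using hr) (by simpa using hx)
  rw [Ft_zero h0, sub_zero, sub_zero] at this
  nlinarith

def PP (F : EE d → EE d) (t : ℝ) : Prop :=
  ∃ E : EE d → EE d, IsSmoothDiffeo E ∧ (∃ m : ℝ, 0 < m ∧ ∀ x, m ≤ |(fderiv ℝ E x).det|) ∧
    ∀ x, ‖x‖ ≤ 1 → E x = Ft F t x

lemma PP_zero (hF : ContDiff ℝ (⊤ : ℕ∞) F) (hH : ContDiff ℝ (⊤ : ℕ∞) H) (hr : ∀ x, F (H x) = x)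
    (hl : ∀ x, H (F x) = x) (hF0 : F 0 = 0) (hH0 : H 0 = 0) : PP F 0 := by
  have hd : IsSmoothDiffeo (Ft F 0) :=
    ⟨Ft_contDiff hF 0, Ft H 0, Ft_contDiff hH 0, fun x => Ft_inv hH hF hl hF0 0 x,
      fun x => Ft_inv hF hH hr hH0 0 x⟩
  refine ⟨Ft F 0, hd, ?_, fun x _ => rfl⟩
  have hfd : ∀ x, fderiv ℝ (Ft F 0) x = fderiv ℝ F 0 := fun x => by
    rw [(Ft_hasFDerivAt hF 0 x).fderiv, zero_smul]
  refine ⟨|(fderiv ℝ F 0).det|, abs_pos.2 ?_, fun x => by rw [hfd]⟩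
  have h1 := det_fderiv_comp (hF.differentiable (by simp)) (hH.differentiable (by simp)) 0
  have h2 : (fun x => F (H x)) = id := funext hr
  rw [h2, fderiv_id, hH0] at h1
  have h3 : (ContinuousLinearMap.id ℝ (EE d)).det = 1 := by simp [ContinuousLinearMap.det]
  rw [h3] at h1
  exact left_ne_zero_of_mul_eq_one h1.symm

lemma PP_step (hF : ContDiff ℝ (⊤ : ℕ∞) F) (hH : ContDiff ℝ (⊤ : ℕ∞) H) (hr : ∀ x, F (H x) = x)
    (hl : ∀ x, H (F x) = x) (hF0 : F 0 = 0) (hH0 : H 0 = 0) :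
    ∃ δ > 0, ∀ s ∈ Icc (0:ℝ) 1, ∀ t ∈ Icc (0:ℝ) 1, |s - t| < δ → PP F t → PP F s := by
  obtain ⟨M, hM, hFM⟩ := Ft_bound hF hF0 1 zero_le_one
  obtain ⟨R, hR, hHR⟩ := Ft_bound hH hH0 (2 * M) (by positivity)
  let b : ContDiffBump (0 : EE d) := ⟨M, 2 * M, hM, by linarith⟩
  have hbs : ContDiff ℝ (⊤ : ℕ∞) b := b.contDiff
  obtain ⟨C1, hC1⟩ := (isCompact_closedBall (0 : EE d) (2 * M)).exists_bound_of_continuousOn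
    (f := fun x => fderiv ℝ b x) (hbs.continuous_fderiv (by simp)).continuousOn
  have hC10 : 0 ≤ C1 := (norm_nonneg _).trans (hC1 0 (by simpa using hM.le))
  obtain ⟨C2, hC2⟩ := (isCompact_closedBall (0 : EE d) (2 * M)).exists_bound_of_continuousOn
    (f := fun x => fderiv ℝ H x) (hH.continuous_fderiv (by simp)).continuousOn
  have hC20 : 0 ≤ C2 := (norm_nonneg _).trans (hC2 0 (by simpa using hM.le))
  -- smallness
  set ε : ℝ := 1 / (2 * (C1 * (2 * M) + 1)) with hε
  have hε0 : 0 < ε := by positivity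
  have hεe : C1 * (ε * (2 * M)) + ε = 1 / 2 := by
    rw [hε]; field_simp
  set ε' : ℝ := ε / (C2 + 1) with hε'
  have hε'0 : 0 < ε' := by positivity
  have huc := (isCompact_closedBall (0 : EE d) R).uniformContinuousOn_of_continuous
    (hF.continuous_fderiv (by simp)).continuousOn
  rw [Metric.uniformContinuousOn_iff] at huc
  obtain ⟨δ, hδ, hδu⟩ := huc ε' hε'0
  refine ⟨δ / R, by positivity, fun s hs t ht hst hP => ?_⟩
  set W : EE d → EE d := fun z => Ft F s (Ft H t z) with hW
  have hWs : ContDiff ℝ (⊤ : ℕ∞) W := (Ft_contDiff hF s).comp (Ft_contDiff hH t)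
  set v : EE d → EE d := fun z => W z - z with hv
  have hvs : ContDiff ℝ (⊤ : ℕ∞) v := hWs.sub contDiff_id
  have hvd : ∀ z, HasFDerivAt v ((fderiv ℝ F (s • Ft H t z) - fderiv ℝ F (t • Ft H t z)).comp
      (fderiv ℝ H (t • z))) z := by
    intro z
    have h1 := (Ft_hasFDerivAt hF s (Ft H t z)).comp z (Ft_hasFDerivAt hH t z)
    have h2 := (Ft_hasFDerivAt hF t (Ft H t z)).comp z (Ft_hasFDerivAt hH t z)
    have h3 := h1.sub h2
    rw [← ContinuousLinearMap.sub_comp] at h3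
    have h4 : (Ft F s ∘ Ft H t - Ft F t ∘ Ft H t) = v := by
      funext z
      simp only [Pi.sub_apply, Function.comp, hv, hW, Ft_inv hF hH hr hH0]
    rwa [h4] at h3
  have hvb : ∀ z ∈ Metric.closedBall (0 : EE d) (2 * M),
      ‖(fderiv ℝ F (s • Ft H t z) - fderiv ℝ F (t • Ft H t z)).comp (fderiv ℝ H (t • z))‖ ≤ ε := by
    intro z hz
    rw [mem_closedBall_zero_iff] at hz
    have hn : ‖Ft H t z‖ ≤ R := hHR t ht z hz
    have hin : ∀ s ∈ Icc (0:ℝ) 1, s • Ft H t z ∈ Metric.closedBall (0 : EE d) R := by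
      intro s hs
      rw [mem_closedBall_zero_iff, norm_smul, Real.norm_of_nonneg hs.1]
      nlinarith [hs.1, hs.2, norm_nonneg (Ft H t z)]
    have h1 := hδu _ (hin s hs) _ (hin t ht) (by
      rw [dist_eq_norm, ← sub_smul, norm_smul, Real.norm_eq_abs]
      rw [lt_div_iff₀ hR] at hst
      nlinarith [abs_nonneg (s - t)])
    rw [dist_eq_norm] at h1
    have h2 : ‖fderiv ℝ H (t • z)‖ ≤ C2 := hC2 _ (by
      rw [mem_closedBall_zero_iff, norm_smul, Real.norm_of_nonneg ht.1]
      nlinarith [ht.1, ht.2, norm_nonneg z])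
    refine (ContinuousLinearMap.opNorm_comp_le _ _).trans ?_
    calc _ ≤ ε' * (C2 + 1) := by gcongr; linarith
      _ = ε := by rw [hε']; field_simp
  have hv0 : v 0 = 0 := by simp [hv, hW, Ft_zero hF0, Ft_zero hH0]
  have hvn : ∀ z ∈ Metric.closedBall (0 : EE d) (2 * M), ‖v z‖ ≤ ε * (2 * M) := by
    intro z hz
    have := (convex_closedBall (0 : EE d) (2 * M)).norm_image_sub_le_of_norm_hasFDerivWithin_le
      (𝕜 := ℝ) (f := v) (C := ε) (x := 0) (y := z)
      (fun x _ => (hvd x).hasFDerivWithinAt) hvb (by simpa using hM.le) hz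
    rw [hv0, sub_zero, sub_zero] at this
    rw [mem_closedBall_zero_iff] at hz
    exact this.trans (by gcongr)
  set u : EE d → EE d := fun z => b z • v z with hu
  have hus : ContDiff ℝ (⊤ : ℕ∞) u := hbs.smul hvs
  have hu0 : ∀ z, 2 * M < ‖z‖ → fderiv ℝ u z = 0 := by
    intro z hz
    have : u =ᶠ[𝓝 z] fun _ => 0 := by
      filter_upwards [continuous_norm.continuousAt.eventually (lt_mem_nhds hz)] with y hy
      simp only [hu]
      rw [b.zero_of_le_dist (by rw [dist_zero_right]; exact le_of_lt hy), zero_smul]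
    rw [this.fderiv_eq]; simp
  have hub : ∀ z, ‖fderiv ℝ u z‖ ≤ 1 / 2 := by
    intro z
    by_cases hz : ‖z‖ ≤ 2 * M
    · have hz' : z ∈ Metric.closedBall (0 : EE d) (2 * M) := by simpa using hz
      have h1 : HasFDerivAt u _ z := ((hbs.differentiable (by simp) z).hasFDerivAt).smul (hvd z)
      rw [h1.fderiv]
      refine (norm_add_le _ _).trans ?_
      rw [norm_smul, ContinuousLinearMap.norm_smulRight_apply, ← hεe, add_comm]
      have e1 : ‖(b z : ℝ)‖ ≤ 1 := by
        rw [Real.norm_of_nonneg b.nonneg]; exact b.le_one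
      have e2 := hvb z hz'
      have e3 := hvn z hz'
      have e4 := hC1 z hz'
      refine add_le_add (mul_le_mul e4 e3 (norm_nonneg _) hC10) ?_
      calc _ ≤ 1 * ε := mul_le_mul e1 e2 (norm_nonneg _) zero_le_one
        _ = ε := one_mul _
    · rw [hu0 z (not_le.1 hz)]; simp
  obtain ⟨hD, m', hm', hDm⟩ := diffeo_of_small hus hub hu0
  obtain ⟨E, hE, ⟨m, hm, hEm⟩, hEe⟩ := hP
  refine ⟨fun x => E x + u (E x), hD.comp' hE, ⟨m' * m, by positivity, fun x => ?_⟩, fun x hx => ?_⟩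
  · have := det_fderiv_comp hD.diff hE.diff x
    rw [this, abs_mul]
    exact mul_le_mul (hDm _) (hEm _) hm.le (abs_nonneg _)
  · show E x + u (E x) = Ft F s x
    rw [hEe x hx]
    have h1 : b (Ft F t x) = 1 := b.one_of_mem_closedBall (by
      rw [mem_closedBall_zero_iff]; exact hFM t ht x hx)
    simp only [hu, h1, one_smul, hv, hW]
    rw [Ft_inv hH hF hl hF0]; abel

lemma step0_centered (hF : ContDiff ℝ (⊤ : ℕ∞) F) (hH : ContDiff ℝ (⊤ : ℕ∞) H)
    (hr : ∀ x, F (H x) = x) (hl : ∀ x, H (F x) = x) (hF0 : F 0 = 0) (hH0 : H 0 = 0) : PP F 1 := by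
  obtain ⟨δ, hδ, hstep⟩ := PP_step hF hH hr hl hF0 hH0
  obtain ⟨n, hn⟩ := exists_nat_one_div_lt hδ
  have hn0 : (0:ℝ) < n + 1 := by positivity
  have key : ∀ j : ℕ, j ≤ n + 1 → PP F (j / (n + 1)) := by
    intro j
    induction j with
    | zero => intro _; simpa using PP_zero hF hH hr hl hF0 hH0
    | succ j ih =>
      intro hj
      have hI : ∀ j : ℕ, j ≤ n + 1 → (j:ℝ) / (n + 1) ∈ Icc (0:ℝ) 1 := fun j hj =>
        ⟨by positivity, by rw [div_le_one hn0]; exact_mod_cast hj⟩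
      refine hstep _ (hI _ hj) _ (hI j (by omega)) ?_ (ih (by omega))
      rw [← sub_div]; push_cast
      rw [add_sub_cancel_left, abs_of_pos (by positivity)]; exact hn
  have := key (n + 1) le_rfl
  push_cast at this
  rwa [div_self hn0.ne'] at this

lemma step0 (hF : IsSmoothDiffeo F) : ∃ E : EE d → EE d, IsSmoothDiffeo E ∧
    (∃ m : ℝ, 0 < m ∧ ∀ x, m ≤ |(fderiv ℝ E x).det|) ∧ ∀ x, ‖x‖ ≤ 1 → E x = F x := by
  obtain ⟨hF, H, hH, hl, hr⟩ := hF
  obtain ⟨E, hE, ⟨m, hm, hEm⟩, hEe⟩ := step0_centered (F := fun x => F x - F 0)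
    (H := fun y => H (y + F 0)) (hF.sub contDiff_const) (hH.comp (contDiff_id.add contDiff_const))
    (fun x => by simp [hr (x + F 0)]) (fun x => by simp [hl x]) (by simp) (by simp [hl 0])
  have hT : IsSmoothDiffeo (fun x : EE d => x + F 0) :=
    ⟨contDiff_id.add contDiff_const, fun x => x - F 0, contDiff_id.sub contDiff_const,
      fun x => by simp, fun x => by simp⟩
  refine ⟨fun x => E x + F 0, hT.comp' hE, ⟨m, hm, fun x => ?_⟩, fun x hx => ?_⟩
  · rw [fderiv_add_const]; exact hEm x
  · show E x + F 0 = F x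
    rw [hEe x hx]; simp [Ft]

end ft

lemma det_fderiv_contDiff {d : ℕ} {E : EE d → EE d} (hE : ContDiff ℝ (⊤ : ℕ∞) E) :
    ContDiff ℝ (⊤ : ℕ∞) (fun x => (fderiv ℝ E x).det) := by
  have h : ∀ x, (fderiv ℝ E x).det = (Matrix.of fun i j => (fderiv ℝ E x (ee j)) i).det := by
    intro x
    rw [ContinuousLinearMap.det,
      ← LinearMap.det_toMatrix (EuclideanSpace.basisFun (Fin d) ℝ).toBasis]
    congr 1
  simp only [h, Matrix.det_apply]
  have hd : ContDiff ℝ (⊤ : ℕ∞) (fderiv ℝ E) := hE.fderiv_right (by simp)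
  refine ContDiff.sum fun σ _ => ContDiff.const_smul _ (contDiff_prod fun i _ => ?_)
  have h1 : ContDiff ℝ (⊤ : ℕ∞) (fun x => fderiv ℝ E x (ee i)) := hd.clm_apply contDiff_const
  exact (contDiff_euclidean.1 h1) (σ i)

lemma exists_const_det {d : ℕ} (hd : 1 ≤ d) {F : EE d → EE d} (hF : IsSmoothDiffeo F) :
    ∃ (Ψ : EE d → EE d) (c : ℝ), 0 < c ∧ IsSmoothDiffeo Ψ ∧
      (∀ x, |(fderiv ℝ Ψ x).det| = c) ∧
      Ψ '' Metric.closedBall 0 1 = F '' Metric.closedBall 0 1 := by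
  obtain ⟨E, hE, ⟨m, hm, hEm⟩, hEe⟩ := step0 hF
  have hs : ContDiff ℝ (⊤ : ℕ∞) (fun x => |(fderiv ℝ E x).det|) :=
    (det_fderiv_contDiff hE.1).abs fun x => abs_pos.1 (hm.trans_le (hEm x))
  obtain ⟨c, hc, G, hG, hGb, hGd⟩ := step1 hd hs hm hEm
  refine ⟨fun x => E (G x), c, hc, hE.comp' hG, fun x => ?_, ?_⟩
  · rw [det_fderiv_comp hE.diff hG.diff, abs_mul]
    exact (hGd x).symm
  · rw [← image_image E G, hGb]
    exact image_congr fun x hx => hEe x (by simpa using hx)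

lemma single_component {d : ℕ} (hd : 1 ≤ d) {F : EE d → EE d} (hF : IsSmoothDiffeo F) :
    ∃ (T : EE d → EE d) (c : ℝ), IsSmoothDiffeo T ∧ MeasurePreserving T volume volume ∧ 0 < c ∧
      ∀ y, y ∈ F '' Metric.closedBall 0 1 ↔ c * ‖T y‖ ^ 2 ≤ 1 := by
  obtain ⟨Ψ, c, hc, ⟨hΨ, S, hS, hl, hr⟩, hdet, him⟩ := exists_const_det hd hF
  have hd0 : d ≠ 0 := by omega
  obtain ⟨r, hr0, hrc⟩ : ∃ r : ℝ, 0 < r ∧ r ^ d = c :=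
    ⟨c ^ ((d : ℝ)⁻¹), Real.rpow_pos_of_pos hc _, Real.rpow_inv_natCast_pow hc.le hd0⟩
  have hT : ContDiff ℝ (⊤ : ℕ∞) (fun y => r • S y) := hS.const_smul r
  have hU : ContDiff ℝ (⊤ : ℕ∞) (fun x => Ψ (r⁻¹ • x)) := hΨ.comp (contDiff_const_smul _)
  have hTU : ∀ x, r • S (Ψ (r⁻¹ • x)) = x := fun x => by
    rw [hl, smul_smul, mul_inv_cancel₀ hr0.ne', one_smul]
  have hUT : ∀ y, Ψ (r⁻¹ • (r • S y)) = y := fun y => by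
    rw [smul_smul, inv_mul_cancel₀ hr0.ne', one_smul, hr]
  refine ⟨fun y => r • S y, (r ^ 2)⁻¹, ⟨hT, fun x => Ψ (r⁻¹ • x), hU, hUT, hTU⟩, ?_,
    by positivity, fun y => ?_⟩
  · refine ⟨hT.continuous.measurable, ?_⟩
    ext s hs
    rw [Measure.map_apply hT.continuous.measurable hs]
    have himg : (fun y => r • S y) ⁻¹' s = (fun x => Ψ (r⁻¹ • x)) '' s := by
      ext y
      constructor
      · intro h; exact ⟨_, h, hUT y⟩
      · rintro ⟨x, hx, rfl⟩
        show r • S (Ψ (r⁻¹ • x)) ∈ s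
        rw [hTU]; exact hx
    have hinj : InjOn (fun x => Ψ (r⁻¹ • x)) s := fun x _ y _ hxy => by
      have := congrArg (fun z => r • S z) hxy
      simpa only [hTU] using this
    have hud : Differentiable ℝ (fun x => Ψ (r⁻¹ • x)) := hU.differentiable (by simp)
    rw [himg, ← lintegral_abs_det_fderiv_eq_addHaar_image volume hs
      (fun x _ => (hud x).hasFDerivAt.hasFDerivWithinAt) hinj]
    have hone : ∀ x, |(fderiv ℝ (fun x => Ψ (r⁻¹ • x)) x).det| = 1 := fun x => by
      have h2 : HasFDerivAt (fun x : EE d => r⁻¹ • x) (r⁻¹ • ContinuousLinearMap.id ℝ (EE d)) x :=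
        (hasFDerivAt_id x).const_smul r⁻¹
      rw [det_fderiv_comp (G := fun x : EE d => r⁻¹ • x) (hΨ.differentiable (by simp))
        (differentiable_id.const_smul r⁻¹), abs_mul, hdet, h2.fderiv]
      have h3 : (r⁻¹ • ContinuousLinearMap.id ℝ (EE d)).det = r⁻¹ ^ d := by
        simp [ContinuousLinearMap.det]
      rw [h3, abs_of_pos (by positivity), ← hrc, inv_pow, mul_inv_cancel₀ (by positivity)]
    simp [hone]
  · rw [← him]
    have h1 : (r ^ 2)⁻¹ * ‖r • S y‖ ^ 2 = ‖S y‖ ^ 2 := by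
      rw [norm_smul, Real.norm_of_nonneg hr0.le, mul_pow, inv_mul_cancel_left₀ (by positivity)]
    rw [h1, sq_le_one_iff₀ (norm_nonneg _)]
    constructor
    · rintro ⟨x, hx, rfl⟩
      rw [hl]; simpa using hx
    · intro h; exact ⟨S y, by simpa using h, hr y⟩

end Helpers

/-- **A finite disjoint union of domains diffeomorphic to closed balls is a sub-level set
of a hard-minimum frontier built from scaled volume-preserving flow components.** -/
theorem disjoint_union_is_sublevel_of_min_frontier
    (d K : ℕ) (hd : 1 ≤ d) (hK : 1 ≤ K)
    (Ω : Fin K → Set (EuclideanSpace ℝ (Fin d)))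
    (F : Fin K → (EuclideanSpace ℝ (Fin d) → EuclideanSpace ℝ (Fin d)))
    (hF : ∀ k, IsSmoothDiffeo (F k))
    (hΩ : ∀ k, Ω k = F k '' Metric.closedBall (0 : EuclideanSpace ℝ (Fin d)) 1)
    (hdisj : Pairwise (Function.onFun Disjoint Ω)) :
    ∃ (T : Fin K → (EuclideanSpace ℝ (Fin d) → EuclideanSpace ℝ (Fin d)))
      (c : Fin K → ℝ),
      (∀ k, IsSmoothDiffeo (T k)) ∧
      (∀ k, MeasurePreserving (T k) volume volume) ∧
      (∀ k, 0 < c k) ∧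
      (⋃ k, Ω k) = {y : EuclideanSpace ℝ (Fin d) | (⨅ k, c k * ‖T k y‖ ^ 2) ≤ 1} := by
  choose T c hT hm hc h using fun k => single_component hd (hF k)
  refine ⟨T, c, hT, hm, hc, ?_⟩
  have : Nonempty (Fin K) := ⟨⟨0, hK⟩⟩
  ext y
  simp only [Set.mem_iUnion, Set.mem_ofPred_eq, hΩ, h]
  constructor
  · rintro ⟨k, hk⟩
    exact (ciInf_le (Set.finite_range _).bddBelow k).trans hk
  · intro hy
    obtain ⟨k, hk⟩ := exists_eq_ciInf_of_finite (f := fun k => c k * ‖T k y‖ ^ 2)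
    exact ⟨k, hk.trans_le hy⟩
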